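/- Fix a prime ℓ, an algebraically closed field k of characteristic ℓ, an integer r ≥ 2, and an integer n > 1. Then the number of pairs (q, [V]), where q is an odd prime power not divisible by ℓ with (r, q) ≠ (2,3), and [V] is an isomorphism class of nontrivial irreducible k-linear representations of the symplectic group Sp_{2r}(F_q) of dimension n with n < (q^r − 1)(q^r − q)/(2(q + 1)), is at most 2. -/

import Mathlib

/-- A representation is irreducible if the only invariant submodules are `⊥` and `⊤`. -/
def Representation.IsIrred {k H V : Type*} [Field k] [Group H] [AddCommGroup V] [Module k V]
    (ρ : Representation k H V) : Prop :=
  ∀ U : Submodule k V, (∀ h : H, ∀ v ∈ U, ρ h v ∈ U) → U = ⊥ ∨ U = ⊤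

/-- The setoid identifying isomorphic (equivariantly linearly equivalent) representations
of `H` on `Fin n → k` satisfying a property `P`.  The classes of this setoid are exactly the
isomorphism classes of `n`-dimensional representations of `H` over `k` satisfying `P`. -/
def repIsoSetoid (k H : Type*) [Field k] [Group H] (n : ℕ)
    (P : Representation k H (Fin n → k) → Prop) :
    Setoid {ρ : Representation k H (Fin n → k) // P ρ} where
  r ρ₁ ρ₂ := ∃ e : (Fin n → k) ≃ₗ[k] (Fin n → k), ∀ (h : H) (v : Fin n → k),
    e (ρ₁.1 h v) = ρ₂.1 h (e v)
  iseqv := by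
    constructor
    · exact fun ρ => ⟨LinearEquiv.refl k _, fun _ _ => rfl⟩
    · rintro a b ⟨e, he⟩
      refine ⟨e.symm, fun h v => ?_⟩
      rw [LinearEquiv.symm_apply_eq, he, e.apply_symm_apply]
    · rintro a b c ⟨e, he⟩ ⟨f, hf⟩
      refine ⟨e.trans f, fun h v => ?_⟩
      simp [LinearEquiv.trans_apply, he, hf]

namespace SymplecticGap

open Matrix Module

section Geometry

variable {r : ℕ} {F : Type*} [Field F]

/-- The symplectic group of size `2r` over `F`. -/
abbrev Sp (r : ℕ) (F : Type*) [Field F] := symplecticGroup (Fin r) F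

/-- The natural module of `Sp r F`. -/
abbrev Vec (r : ℕ) (F : Type*) := Fin r ⊕ Fin r → F

/-- The symplectic form preserved by `Sp r F`. -/
def form (r : ℕ) (F : Type*) [Field F] : Vec r F →ₗ[F] Vec r F →ₗ[F] F :=
  Matrix.toLinearMap₂' F (J (Fin r) F)

local notation "ω" => form _ _

theorem form_apply (x y : Vec r F) : ω x y = x ⬝ᵥ (J (Fin r) F *ᵥ y) := by
  simp [form, Matrix.toLinearMap₂'_apply']

theorem form_sumElim (a b c d : Fin r → F) :
    ω (Sum.elim a b) (Sum.elim c d) = b ⬝ᵥ c - a ⬝ᵥ d := by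
  rw [form_apply, J, fromBlocks_mulVec]
  simp [sumElim_dotProduct_sumElim, neg_mulVec]
  ring

theorem form_neg_swap (x y : Vec r F) : ω y x = -ω x y := by
  rw [← Sum.elim_comp_inl_inr x, ← Sum.elim_comp_inl_inr y, form_sumElim, form_sumElim,
    dotProduct_comm, dotProduct_comm (y ∘ Sum.inl)]
  ring

@[simp] theorem form_self (x : Vec r F) : ω x x = 0 := by
  rw [← Sum.elim_comp_inl_inr x, form_sumElim, dotProduct_comm, sub_self]

theorem form_nondegenerate {x : Vec r F} (hx : x ≠ 0) : ∃ y, ω x y ≠ 0 := by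
  by_contra! h
  apply hx
  ext (i | i)
  · have := h (Sum.elim 0 (Pi.single i 1))
    rw [← Sum.elim_comp_inl_inr x, form_sumElim] at this
    simpa using this
  · have := h (Sum.elim (Pi.single i 1) 0)
    rw [← Sum.elim_comp_inl_inr x, form_sumElim] at this
    simpa using this

/-- Every linear functional is represented by the symplectic form. -/
theorem exists_form_eq (f : Dual F (Vec r F)) : ∃ y, ∀ x, f x = ω x y := by
  have hinj : Function.Injective (form r F).flip := by
    rw [injective_iff_map_eq_zero]
    intro y hy
    by_contra hne
    obtain ⟨x, hx⟩ := form_nondegenerate hne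
    apply hx
    rw [form_neg_swap, ← LinearMap.flip_apply, hy]
    simp
  have hsurj : Function.Surjective (form r F).flip :=
    (LinearMap.injective_iff_surjective_of_finrank_eq_finrank
      (Subspace.dual_finrank_eq (K := F)).symm).mp hinj
  obtain ⟨y, hy⟩ := hsurj f
  exact ⟨y, fun x => by rw [← hy]; rfl⟩

/-- The action of the symplectic group on its natural module. -/
def act (g : Sp r F) : Vec r F →ₗ[F] Vec r F := Matrix.mulVecLin g.1

theorem act_mul (g h : Sp r F) (x : Vec r F) : act (g * h) x = act g (act h x) := by
  simp [act]

@[simp] theorem act_one (x : Vec r F) : act (1 : Sp r F) x = x := by simp [act]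

theorem act_inv_act (g : Sp r F) (x : Vec r F) : act g⁻¹ (act g x) = x := by
  rw [← act_mul, inv_mul_cancel, act_one]

theorem act_act_inv (g : Sp r F) (x : Vec r F) : act g (act g⁻¹ x) = x := by
  rw [← act_mul, mul_inv_cancel, act_one]

theorem act_ext {g h : Sp r F} (H : ∀ x, act g x = act h x) : g = h :=
  Subtype.ext (Matrix.mulVec_injective (funext fun x => H x))

theorem form_act (g : Sp r F) (x y : Vec r F) : ω (act g x) (act g y) = ω x y := by
  have h := SymplecticGroup.mem_iff'.mp g.2
  simp only [form_apply, act, mulVecLin_apply]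
  conv_rhs => rw [← h, ← mulVec_mulVec, ← mulVec_mulVec, Matrix.dotProduct_mulVec x,
    vecMul_transpose]

/-- A linear map preserving the symplectic form, as an element of the symplectic group. -/
def ofLinear (f : Vec r F →ₗ[F] Vec r F) (hf : ∀ x y, ω (f x) (f y) = ω x y) : Sp r F :=
  ⟨LinearMap.toMatrix' f, by
    rw [SymplecticGroup.mem_iff']
    have h : (form r F).compl₁₂ f f = form r F := LinearMap.ext₂ hf
    have := congrArg (LinearMap.toMatrix₂' F) h
    rw [LinearMap.toMatrix₂'_compl₁₂] at this
    simpa [form] using this⟩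

@[simp] theorem act_ofLinear (f : Vec r F →ₗ[F] Vec r F) (hf) (x : Vec r F) :
    act (ofLinear f hf) x = f x := by
  simp [act, ofLinear]

/-- The transvection `x ↦ x + c ω(x, v) v`. -/
def transv (v : Vec r F) (c : F) : Sp r F :=
  ofLinear (LinearMap.id + c • ((form r F).flip v).smulRight v) fun x y => by
    simp [form_neg_swap v y]; ring

theorem act_transv (v : Vec r F) (c : F) (x : Vec r F) :
    act (transv v c) x = x + (c * ω x v) • v := by
  simp [transv, smul_smul]

/-- The Siegel transformation `x ↦ x + ω(x, u) v + ω(x, v) u` of an orthogonal pair. -/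
def siegel (u v : Vec r F) : Sp r F := transv (u + v) 1 * transv u (-1) * transv v (-1)

theorem act_siegel {u v : Vec r F} (h : ω u v = 0) (x : Vec r F) :
    act (siegel u v) x = x + ω x u • v + ω x v • u := by
  have h' : ω v u = 0 := by rw [form_neg_swap, h, neg_zero]
  simp only [siegel, act_mul, act_transv, map_add, map_smul, form_self, h, h']
  module

theorem siegel_comm {u v : Vec r F} (h : ω u v = 0) : siegel u v = siegel v u := by
  have h' : ω v u = 0 := by rw [form_neg_swap, h, neg_zero]
  refine act_ext fun x => ?_
  rw [act_siegel h, act_siegel h']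
  module

theorem transv_zero_right (v : Vec r F) : transv v 0 = 1 :=
  act_ext fun x => by simp [act_transv]

theorem transv_add_right (v : Vec r F) (a b : F) : transv v (a + b) = transv v a * transv v b :=
  act_ext fun x => by
    simp only [act_mul, act_transv, map_add, map_smul, form_self]
    module

theorem transv_smul (s : F) (v : Vec r F) (c : F) : transv (s • v) c = transv v (s ^ 2 * c) :=
  act_ext fun x => by
    simp only [act_transv, map_smul, smul_eq_mul]
    module

theorem transv_zero_left (c : F) : transv (0 : Vec r F) c = 1 :=
  act_ext fun x => by simp [act_transv]

theorem conj_transv (g : Sp r F) (v : Vec r F) (c : F) :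
    g * transv v c * g⁻¹ = transv (act g v) c :=
  act_ext fun x => by
    rw [act_mul, act_mul, act_transv, act_transv, map_add, act_act_inv, map_smul,
      ← form_act g, act_act_inv]

theorem transv_commute {u v : Vec r F} (h : ω u v = 0) (a b : F) :
    transv u a * transv v b = transv v b * transv u a := by
  have h' : ω v u = 0 := by rw [form_neg_swap, h, neg_zero]
  refine act_ext fun x => ?_
  simp only [act_mul, act_transv, map_add, map_smul, h, h']
  module

theorem transv_add_left {u v : Vec r F} (h : ω u v = 0) (c : F) :
    transv (u + v) c = siegel u (c • v) * transv u c * transv v c := by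
  have h' : ω v u = 0 := by rw [form_neg_swap, h, neg_zero]
  refine act_ext fun x => ?_
  simp only [act_mul, act_siegel (u := u) (v := c • v) (by simp [h]), act_transv, map_add,
    map_smul, LinearMap.add_apply, LinearMap.smul_apply, form_self, smul_eq_mul, h, h']
  module

theorem siegel_mul_siegel {u x y : Vec r F} (hx : ω u x = 0) (hy : ω u y = 0) :
    siegel u x * siegel u y = siegel u (x + y) * transv u (ω y x) := by
  have hx' : ω x u = 0 := by rw [form_neg_swap, hx, neg_zero]
  have hy' : ω y u = 0 := by rw [form_neg_swap, hy, neg_zero]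
  refine act_ext fun z => ?_
  simp only [act_mul, act_siegel hx, act_siegel hy, act_siegel (u := u) (v := x + y)
    (by simp [hx, hy]), act_transv, map_add,
    map_smul, LinearMap.add_apply, LinearMap.smul_apply, form_self, smul_eq_mul, hx, hy, hy']
  module

theorem conj_siegel (g : Sp r F) (u v : Vec r F) :
    g * siegel u v * g⁻¹ = siegel (act g u) (act g v) := by
  simp only [siegel, ← map_add, ← conj_transv]
  group

end Geometry

local notation "ω" => form _ _

section Generation

variable {r : ℕ} {F : Type*} [Field F]

/-- The subgroup generated by all transvections. -/
def transvSubgroup (r : ℕ) (F : Type*) [Field F] : Subgroup (Sp r F) :=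
  Subgroup.closure {g | ∃ v c, g = transv v c}

theorem transv_mem (v : Vec r F) (c : F) : transv v c ∈ transvSubgroup r F :=
  Subgroup.subset_closure ⟨v, c, rfl⟩

theorem exists_transv_map_of_form_ne_zero (M : Submodule F (Vec r F)) {x y : Vec r F}
    (hxy : ω x y ≠ 0) (h : ∀ m ∈ M, ω x m = ω y m) :
    ∃ g ∈ transvSubgroup r F, act g x = y ∧ ∀ m ∈ M, act g m = m := by
  refine ⟨transv (y - x) (ω x y)⁻¹, transv_mem _ _, ?_, fun m hm => ?_⟩
  · rw [act_transv, map_sub, form_self, sub_zero, inv_mul_cancel₀ hxy]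
    module
  · rw [act_transv, map_sub, form_neg_swap y m, form_neg_swap x m, h m hm]
    simp

theorem exists_form_ne_zero_of_notMem (M : Submodule F (Vec r F)) {x : Vec r F} (hx : x ∉ M) :
    ∃ k, ω x k ≠ 0 ∧ ∀ m ∈ M, ω m k = 0 := by
  obtain ⟨f, hf, hM⟩ := Submodule.exists_le_ker_of_notMem hx
  obtain ⟨k, hk⟩ := exists_form_eq f
  exact ⟨k, hk x ▸ hf, fun m hm => hk m ▸ hM hm⟩

theorem exists_transv_map (M : Submodule F (Vec r F)) {x y : Vec r F} (hx : x ∉ M) (hy : y ∉ M)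
    (h : ∀ m ∈ M, ω x m = ω y m) :
    ∃ g ∈ transvSubgroup r F, act g x = y ∧ ∀ m ∈ M, act g m = m := by
  by_cases hxy : ω x y = 0
  · obtain ⟨k, hxk, hyk, hk⟩ : ∃ k, ω x k ≠ 0 ∧ ω y k ≠ 0 ∧ ∀ m ∈ M, ω m k = 0 := by
      obtain ⟨k, hxk, hk⟩ := exists_form_ne_zero_of_notMem M hx
      obtain ⟨l, hyl, hl⟩ := exists_form_ne_zero_of_notMem M hy
      by_cases hyk : ω y k = 0
      · by_cases hxl : ω x l = 0
        · exact ⟨k + l, by simpa [hxl], by simpa [hyk],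
            fun m hm => by simp [hk m hm, hl m hm]⟩
        · exact ⟨l, hxl, hyl, hl⟩
      · exact ⟨k, hxk, hyk, hk⟩
    have hk' : ∀ m ∈ M, ω k m = 0 := fun m hm => by rw [form_neg_swap, hk m hm, neg_zero]
    obtain ⟨g, hg, hgx, hgM⟩ := exists_transv_map_of_form_ne_zero M (x := x) (y := x + k)
      (by simpa) fun m hm => by simp [hk' m hm]
    obtain ⟨g', hg', hgx', hgM'⟩ := exists_transv_map_of_form_ne_zero M (x := x + k) (y := y)
      (by simpa [hxy, form_neg_swap y k] using hyk) fun m hm => by simp [hk' m hm, h m hm]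
    refine ⟨g' * g, mul_mem hg' hg, by rw [act_mul, hgx, hgx'], fun m hm => ?_⟩
    rw [act_mul, hgM m hm, hgM' m hm]
  · exact exists_transv_map_of_form_ne_zero M hxy h

/-- Witt's theorem: isometric independent families are conjugate under transvections. -/
theorem exists_transv_map_family {n : ℕ} (x y : Fin n → Vec r F) (hx : LinearIndependent F x)
    (hy : LinearIndependent F y) (h : ∀ i j, ω (x i) (x j) = ω (y i) (y j)) :
    ∃ g ∈ transvSubgroup r F, ∀ i, act g (x i) = y i := by
  induction n with
  | zero => exact ⟨1, one_mem _, fun i => i.elim0⟩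
  | succ n ih =>
    obtain ⟨hx₁, hx₂⟩ := linearIndependent_finSucc'.mp hx
    obtain ⟨hy₁, hy₂⟩ := linearIndependent_finSucc'.mp hy
    obtain ⟨g, hg, hgx⟩ := ih (Fin.init x) (Fin.init y) hx₁ hy₁ fun i j => h _ _
    have hnot : act g (x (Fin.last n)) ∉ Submodule.span F (Set.range (Fin.init y)) := by
      intro hmem
      apply hx₂
      have := Submodule.mem_map_of_mem (f := act g⁻¹) hmem
      rw [act_inv_act, Submodule.map_span, ← Set.range_comp] at this
      have hcomp : ⇑(act g⁻¹) ∘ Fin.init y = Fin.init x := funext fun i => by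
        rw [Function.comp_apply, ← hgx i, act_inv_act]
      rwa [hcomp] at this
    have hform : ∀ m ∈ Submodule.span F (Set.range (Fin.init y)),
        ω (act g (x (Fin.last n))) m = ω (y (Fin.last n)) m := by
      intro m hm
      induction hm using Submodule.span_induction with
      | mem m hm =>
        obtain ⟨i, rfl⟩ := hm
        rw [← hgx i, form_act, hgx i]
        exact h _ _
      | zero => simp
      | add a b _ _ ha hb => simp [ha, hb]
      | smul c a _ ha => simp [ha]
    obtain ⟨g', hg', hgl, hgM⟩ := exists_transv_map _ hnot hy₂ hform
    refine ⟨g' * g, mul_mem hg' hg, fun i => ?_⟩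
    rw [act_mul]
    refine Fin.lastCases hgl (fun i => ?_) i
    have := hgx i
    simp only [Fin.init] at this
    rw [this]
    exact hgM _ (Submodule.subset_span ⟨i, rfl⟩)

theorem transvSubgroup_eq_top : transvSubgroup r F = ⊤ := by
  rw [eq_top_iff]
  intro g _
  let b := (Module.finBasis F (Vec r F))
  have hg : Function.Injective (act g) := fun x y hxy => by
    rw [← act_inv_act g x, hxy, act_inv_act]
  obtain ⟨g', hg', h⟩ := exists_transv_map_family b (fun i => act g (b i)) b.linearIndependent
    (b.linearIndependent.map' _ (LinearMap.ker_eq_bot.mpr hg)) fun i j => (form_act g _ _).symm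
  have : act g' = act g := b.ext h
  rwa [← act_ext (g := g') (h := g) fun x => by rw [this]]

theorem exists_act_pair {u v u' v' : Vec r F} (h : LinearIndependent F ![u, v])
    (h' : LinearIndependent F ![u', v']) (huv : ω u v = ω u' v') :
    ∃ g : Sp r F, act g u = u' ∧ act g v = v' := by
  obtain ⟨g, -, hg⟩ := exists_transv_map_family ![u, v] ![u', v'] h h' (by
    have := form_neg_swap u v
    have := form_neg_swap u' v'
    intro i j
    fin_cases i <;> fin_cases j <;> simp_all)
  exact ⟨g, hg 0, hg 1⟩

end Generation

section Weights

variable {k V F X : Type*} [Field k] [AddCommGroup V] [Module k V] [Field F]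
  [AddCommGroup X] [Module F X]

/-- The subspace on which the operators `R x` act through the character `x ↦ ψ (f x)`. -/
def weightSpace (ψ : AddChar F k) (R : X → V →ₗ[k] V) (f : Dual F X) : Submodule k V where
  carrier := {v | ∀ x, R x v = ψ (f x) • v}
  add_mem' ha hb x := by rw [map_add, ha x, hb x, smul_add]
  zero_mem' x := by simp
  smul_mem' c v hv x := by rw [map_smul, hv x, smul_comm]

variable {ψ : AddChar F k} {R : X → V →ₗ[k] V}

theorem sum_addChar_dual [Fintype X] (hψ : ψ ≠ 1) {f : Dual F X} (hf : f ≠ 0) :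
    ∑ x, ψ (f x) = 0 := by
  obtain ⟨a, ha⟩ := (AddChar.ne_one_iff).mp hψ
  have hsurj := f.surjective_of_ne_zero hf
  obtain ⟨x, hx⟩ := hsurj a
  exact AddChar.sum_eq_zero_of_ne_one (ψ := ψ.compAddMonoidHom f.toAddMonoidHom)
    (AddChar.ne_one_iff.mpr ⟨x, by simpa [hx] using ha⟩)

theorem sum_addChar_eval [Finite X] [Fintype (Dual F X)] (hψ : ψ ≠ 1) {x : X} (hx : x ≠ 0) :
    ∑ f : Dual F X, ψ (f x) = 0 := by
  have : Module.Finite F X := inferInstance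
  refine sum_addChar_dual (X := Dual F X) hψ (f := Dual.eval F X x) fun h => hx ?_
  exact (Module.forall_dual_apply_eq_zero_iff F x).mp fun f => by
    rw [← Dual.eval_apply, h, LinearMap.zero_apply]

/-- The projection onto a weight space. -/
noncomputable def weightProj [Fintype X] (ψ : AddChar F k) (R : X → V →ₗ[k] V) (f : Dual F X) :
    V →ₗ[k] V :=
  (Fintype.card X : k)⁻¹ • ∑ x, ψ (-f x) • R x

theorem weightProj_mem [Fintype X] (hR : ∀ x y, R (x + y) = R x * R y) (f : Dual F X) (v : V) :
    weightProj ψ R f v ∈ weightSpace ψ R f := by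
  intro y
  have : ∑ x, ψ (-f x) • R y (R x v) = ψ (f y) • ∑ x, ψ (-f x) • R x v := by
    rw [Finset.smul_sum, ← Equiv.sum_comp (Equiv.addLeft y) fun x => ψ (f y) • ψ (-f x) • R x v]
    refine Finset.sum_congr rfl fun x _ => ?_
    rw [← Module.End.mul_apply, ← hR, smul_smul, ← AddChar.map_add_eq_mul]
    simp
  simp only [weightProj, LinearMap.smul_apply, LinearMap.sum_apply, map_smul, map_sum, this]
  rw [smul_comm]

theorem weightProj_apply_self [Fintype X] (hX : (Fintype.card X : k) ≠ 0) {f : Dual F X} {v : V}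
    (hv : v ∈ weightSpace ψ R f) : weightProj ψ R f v = v := by
  have (x : X) : ψ (-f x) • R x v = v := by
    rw [hv x, smul_smul, ← AddChar.map_add_eq_mul]; simp
  simp [weightProj, this, ← Nat.cast_smul_eq_nsmul k, smul_smul, hX]

theorem weightProj_apply_of_ne [Fintype X] (hψ : ψ ≠ 1) {f g : Dual F X} (hfg : f ≠ g) {v : V}
    (hv : v ∈ weightSpace ψ R g) : weightProj ψ R f v = 0 := by
  have (x : X) : ψ (-f x) • R x v = ψ ((g - f) x) • v := by
    rw [hv x, smul_smul, ← AddChar.map_add_eq_mul, LinearMap.sub_apply, neg_add_eq_sub]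
  simp [weightProj, this, ← Finset.sum_smul, -LinearMap.sub_apply,
    sum_addChar_dual hψ (sub_ne_zero.mpr hfg.symm)]

theorem sum_weightProj [Fintype X] [Fintype (Dual F X)] (hψ : ψ ≠ 1)
    (hX : (Fintype.card X : k) ≠ 0) (hR : R 0 = 1) : ∑ f, weightProj ψ R f = 1 := by
  have : Module.Finite F X := inferInstance
  have hcard : Fintype.card (Dual F X) = Fintype.card X :=
    Fintype.card_congr (Module.finBasis F X).toDualEquiv.toEquiv.symm
  have : ∑ f : Dual F X, ∑ x, ψ (-f x) • R x = (Fintype.card X : k) • 1 := by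
    rw [Finset.sum_comm, Finset.sum_eq_single (0 : X)]
    · simp [hR, hcard, ← Nat.cast_smul_eq_nsmul k]
    · intro x _ hx
      rw [← Finset.sum_smul]
      simp_rw [← map_neg]
      rw [sum_addChar_eval hψ (neg_ne_zero.mpr hx), zero_smul]
    · simp
  simp only [weightProj]
  rw [← Finset.smul_sum, this, smul_smul, inv_mul_cancel₀ hX, one_smul]

theorem iSup_weightSpace [Finite F] [Finite X] (hψ : ψ ≠ 1) (hX : (Nat.card X : k) ≠ 0) (hR₀ : R 0 = 1)
    (hR : ∀ x y, R (x + y) = R x * R y) : ⨆ f, weightSpace ψ R f = ⊤ := by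
  have := Fintype.ofFinite X
  have : Finite (Dual F X) := Module.finite_of_finite F
  have := Fintype.ofFinite (Dual F X)
  rw [Nat.card_eq_fintype_card] at hX
  rw [eq_top_iff]
  intro v _
  rw [← Module.End.one_apply (R := k) v, ← sum_weightProj hψ hX hR₀, LinearMap.sum_apply]
  exact sum_mem fun f _ => Submodule.mem_iSup_of_mem f (weightProj_mem hR f v)

theorem iSupIndep_weightSpace [Finite X] (hψ : ψ ≠ 1) (hX : (Nat.card X : k) ≠ 0) :
    iSupIndep (weightSpace (X := X) ψ R) := by
  have := Fintype.ofFinite X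
  rw [Nat.card_eq_fintype_card] at hX
  intro f
  rw [Submodule.disjoint_def]
  intro v hv hv'
  rw [← weightProj_apply_self hX hv]
  have : ⨆ g, ⨆ (_ : g ≠ f), weightSpace ψ R g ≤ LinearMap.ker (weightProj ψ R f) :=
    iSup₂_le fun g hg v hv => weightProj_apply_of_ne hψ hg.symm hv
  exact this hv'

end Weights

section OrbitBound

variable {F X : Type*} [Field F] [AddCommGroup X] [Module F X]

/-- The points of the conic `a p² + b s² = a`. -/
def conic (a b : F) : Set (F × F) := {z | a * z.1 ^ 2 + b * z.2 ^ 2 = a}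

open Classical in
/-- The slope of the line joining a point of the conic to `(1, 0)`. -/
noncomputable def slope (z : F × F) : Option F := if z.1 = 1 then none else some (z.2 / (z.1 - 1))

theorem slope_relation {a b : F} {z : F × F} (hz : z ∈ conic a b) {m : F}
    (hm : slope z = some m) : z.1 ≠ 1 ∧ z.2 = m * (z.1 - 1) ∧ z.1 * (a + b * m ^ 2) = b * m ^ 2 - a := by
  unfold slope at hm
  split_ifs at hm with h
  have h' : z.1 - 1 ≠ 0 := sub_ne_zero.mpr h
  have h2 : z.2 = m * (z.1 - 1) := by
    rw [← Option.some_injective _ hm]; field_simp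
  refine ⟨h, h2, ?_⟩
  have hz' : a * z.1 ^ 2 + b * z.2 ^ 2 = a := hz
  rw [h2] at hz'
  apply mul_left_cancel₀ h'
  linear_combination hz'

theorem slope_injOn {a b : F} (h2 : (2 : F) ≠ 0) (ha : a ≠ 0) (hb : b ≠ 0) :
    Set.InjOn slope (conic a b) := by
  intro z hz w hw h
  rcases hs : slope z with _ | m
  · have key : ∀ y ∈ conic a b, slope y = none → y = (1, 0) := by
      intro y hy hyn
      unfold slope at hyn
      split_ifs at hyn with h1
      have hy' : a * y.1 ^ 2 + b * y.2 ^ 2 = a := hy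
      rw [h1] at hy'
      have : b * y.2 ^ 2 = 0 := by linear_combination hy'
      have : y.2 = 0 := by simpa [hb] using this
      exact Prod.ext h1 this
    rw [key z hz hs, key w hw (h ▸ hs)]
  · obtain ⟨-, h1, h3⟩ := slope_relation hz hs
    obtain ⟨-, h1', h3'⟩ := slope_relation hw (h ▸ hs)
    have hne : a + b * m ^ 2 ≠ 0 := by
      intro h0
      rw [h0, mul_zero] at h3
      have : 2 * a = 0 := by linear_combination h0 + h3
      simp [h2, ha] at this
    have : z.1 = w.1 := mul_right_cancel₀ hne (h3.trans h3'.symm)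
    exact Prod.ext this (by rw [h1, h1', this])

theorem ncard_conic_le [Fintype F] {a b : F} (h2 : (2 : F) ≠ 0) (ha : a ≠ 0) (hb : b ≠ 0) :
    (conic a b).ncard ≤ Fintype.card F + 1 := by
  rw [← (slope_injOn h2 ha hb).ncard_image, ← Fintype.card_option,
    ← Nat.card_eq_fintype_card, ← Set.ncard_univ]
  exact Set.ncard_le_ncard (Set.subset_univ _)

theorem ncard_conic_le_of_isotropic [Fintype F] {a b m : F} (h2 : (2 : F) ≠ 0) (ha : a ≠ 0)
    (hb : b ≠ 0) (hm : a + b * m ^ 2 = 0) : (conic a b).ncard ≤ Fintype.card F - 1 := by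
  have hm0 : m ≠ 0 := by
    rintro rfl
    simp [ha] at hm
  have hmm : (some m : Option F) ≠ some (-m) := by
    intro h
    have : 2 * m = 0 := by linear_combination Option.some_injective _ h
    simp [h2, hm0] at this
  have hmiss : ∀ c : F, c ^ 2 = m ^ 2 → some c ∉ slope '' conic a b := by
    rintro c hc ⟨z, hz, hs⟩
    obtain ⟨-, -, h3⟩ := slope_relation hz hs
    rw [hc, hm, mul_zero] at h3
    have : 2 * a = 0 := by linear_combination hm + h3
    simp [h2, ha] at this
  rw [← (slope_injOn h2 ha hb).ncard_image]
  have hsub : slope '' conic a b ⊆ ({some m, some (-m)} : Set (Option F))ᶜ := by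
    rintro y hy (rfl | rfl)
    · exact hmiss m rfl hy
    · exact hmiss (-m) (by ring) hy
  refine (Set.ncard_le_ncard hsub).trans ?_
  rw [Set.ncard_compl, Set.ncard_pair hmm, Nat.card_eq_fintype_card, Fintype.card_option]
  omega

/-- Pairs of covectors with the same diagonal quadratic form as a given pair. -/
def sameForm (a b : F) (ξ₀ η₀ : Dual F X) : Set (Dual F X × Dual F X) :=
  {z | ∀ x, a * z.1 x ^ 2 + b * z.2 x ^ 2 = a * ξ₀ x ^ 2 + b * η₀ x ^ 2}

theorem ncard_sameForm_le [Finite F] {a b : F} (h2 : (2 : F) ≠ 0) (ha : a ≠ 0) (hb : b ≠ 0)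
    {ξ₀ η₀ : Dual F X} {x₀ y₀ : X} (h11 : ξ₀ x₀ = 1) (h12 : η₀ x₀ = 0) (h21 : ξ₀ y₀ = 0)
    (h22 : η₀ y₀ = 1) : (sameForm a b ξ₀ η₀).ncard ≤ 2 * (conic a b).ncard := by
  have pol : ∀ z ∈ sameForm a b ξ₀ η₀, ∀ x y,
      a * (z.1 x * z.1 y) + b * (z.2 x * z.2 y) = a * (ξ₀ x * ξ₀ y) + b * (η₀ x * η₀ y) := by
    intro z hz x y
    have e1 := hz x
    have e2 := hz y
    have e3 := hz (x + y)
    simp only [map_add] at e3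
    apply mul_left_cancel₀ h2
    linear_combination e3 - e1 - e2
  let δ : Dual F X × Dual F X → F := fun z => z.1 x₀ * z.2 y₀ - z.1 y₀ * z.2 x₀
  have key : ∀ z ∈ sameForm a b ξ₀ η₀, (z.1 x₀, z.2 x₀) ∈ conic a b ∧ δ z ^ 2 = 1 ∧
      z.2 y₀ = z.1 x₀ * δ z ∧ a * z.1 y₀ = -(b * z.2 x₀ * δ z) := by
    intro z hz
    have e1 := pol z hz x₀ x₀
    have e2 := pol z hz x₀ y₀
    have e3 := pol z hz y₀ y₀
    simp only [h11, h12, h21, h22] at e1 e2 e3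
    have c1 : z.2 y₀ = z.1 x₀ * δ z := by
      apply mul_left_cancel₀ ha
      simp only [δ]
      linear_combination -z.2 y₀ * e1 + z.2 x₀ * e2
    have c2 : a * z.1 y₀ = -(b * z.2 x₀ * δ z) := by
      simp only [δ]
      linear_combination -z.1 y₀ * e1 + z.1 x₀ * e2
    have c3 : b * δ z ^ 2 = b := by
      apply mul_left_cancel₀ ha
      have : a * (a * z.1 y₀ ^ 2 + b * z.2 y₀ ^ 2) = a * b := by rw [← mul_one b]; linear_combination a * e3
      have h4 : (a * z.1 y₀) ^ 2 + a * b * z.2 y₀ ^ 2 = a * b := by linear_combination this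
      rw [c1, c2] at h4
      linear_combination h4 - b * δ z ^ 2 * e1
    refine ⟨by simpa [conic, pow_two] using e1, ?_, c1, c2⟩
    exact mul_left_cancel₀ hb (by rw [c3, mul_one])
  have hinj : Set.InjOn (fun z : Dual F X × Dual F X => ((z.1 x₀, z.2 x₀), δ z))
      (sameForm a b ξ₀ η₀) := by
    intro z hz w hw h
    simp only [Prod.mk.injEq] at h
    obtain ⟨⟨hp, hs⟩, hd⟩ := h
    obtain ⟨-, d2, t1, u1⟩ := key z hz
    obtain ⟨-, -, t2, u2⟩ := key w hw
    have ht : z.2 y₀ = w.2 y₀ := by rw [t1, t2, hp, hd]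
    have hu : z.1 y₀ = w.1 y₀ := mul_left_cancel₀ ha (by rw [u1, u2, hs, hd])
    have hd0 : δ z ≠ 0 := fun h => by simp [h] at d2
    have hx : ∀ x, z.1 x = w.1 x ∧ z.2 x = w.2 x := by
      intro x
      have e1 := pol z hz x x₀
      have e2 := pol z hz x y₀
      have f1 := pol w hw x x₀
      have f2 := pol w hw x y₀
      rw [← hp, ← hs] at f1
      rw [← hu, ← ht] at f2
      constructor
      · apply mul_left_cancel₀ (mul_ne_zero ha hd0)
        simp only [δ]
        linear_combination z.2 y₀ * (e1 - f1) - z.2 x₀ * (e2 - f2)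
      · apply mul_left_cancel₀ (mul_ne_zero hb hd0)
        simp only [δ]
        linear_combination z.1 x₀ * (e2 - f2) - z.1 y₀ * (e1 - f1)
    exact Prod.ext (LinearMap.ext fun x => (hx x).1) (LinearMap.ext fun x => (hx x).2)
  have hfin : (conic a b ×ˢ ({1, -1} : Set F)).Finite := Set.toFinite _
  refine (Set.ncard_le_ncard_of_injOn _ (t := conic a b ×ˢ ({1, -1} : Set F)) ?_ hinj hfin).trans ?_
  · intro z hz
    obtain ⟨h1, h3, -⟩ := key z hz
    refine ⟨h1, ?_⟩
    simpa using sq_eq_sq_iff_eq_or_eq_neg.mp (h3.trans (one_pow 2).symm)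
  · rw [Set.ncard_prod, mul_comm]
    exact Nat.mul_le_mul_right _ ((Set.ncard_insert_le _ _).trans (by simp))

end OrbitBound

section OrbitBound

variable {F X : Type*} [Field F] [AddCommGroup X] [Module F X]

/-- The orbit of the quadratic form of `B` under linear substitutions. -/
def formOrbit (B : X →ₗ[F] X →ₗ[F] F) : Set (X → F) :=
  {h | ∃ g : X ≃ₗ[F] X, ∀ x, h x = B (g x) (g x)}

/-- `x₀, y₀` is a pair dual to a pair of covectors. -/
def HasDualPair (z : Dual F X × Dual F X) : Prop :=
  ∃ x₀ y₀, z.1 x₀ = 1 ∧ z.2 x₀ = 0 ∧ z.1 y₀ = 0 ∧ z.2 y₀ = 1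

theorem ncard_le_mul_ncard_formOrbit [Finite F] [Finite X] (B : X →ₗ[F] X →ₗ[F] F) {a b : F}
    (h2 : (2 : F) ≠ 0) (ha : a ≠ 0) (hb : b ≠ 0) (κ : X → F) (Ω : Set (Dual F X × Dual F X))
    (hdual : ∀ z ∈ Ω, HasDualPair z)
    (horb : ∀ z ∈ Ω, (fun x => a * z.1 x ^ 2 + b * z.2 x ^ 2 + κ x) ∈ formOrbit B) :
    Ω.ncard ≤ 2 * (conic a b).ncard * (formOrbit B).ncard := by
  classical
  have : Finite (Dual F X) := Finite.of_injective (fun f : Dual F X => (f : X → F))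
    DFunLike.coe_injective
  have := Fintype.ofFinite (Dual F X)
  have := Fintype.ofFinite F
  have := Fintype.ofFinite X
  rw [Set.ncard_eq_toFinset_card' Ω, Set.ncard_eq_toFinset_card' (formOrbit B)]
  refine Finset.card_le_mul_card_image_of_maps_to
    (f := fun z : Dual F X × Dual F X => fun x => a * z.1 x ^ 2 + b * z.2 x ^ 2 + κ x)
    (fun z hz => by simpa using horb z (by simpa using hz)) _ fun h _ => ?_
  by_cases hne : ∃ z₀ ∈ Ω, (fun x => a * z₀.1 x ^ 2 + b * z₀.2 x ^ 2 + κ x) = h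
  · obtain ⟨z₀, hz₀, rfl⟩ := hne
    obtain ⟨x₀, y₀, h11, h12, h21, h22⟩ := hdual z₀ hz₀
    refine le_trans ?_ (ncard_sameForm_le h2 ha hb h11 h12 h21 h22)
    rw [Set.ncard_eq_toFinset_card']
    refine Finset.card_le_card fun z hz => ?_
    simp only [Finset.mem_filter, Set.mem_toFinset] at hz ⊢
    intro x
    have := congrFun hz.2 x
    simpa using this
  · rw [Finset.card_eq_zero.mpr]
    · exact Nat.zero_le _
    · rw [Finset.filter_eq_empty_iff]
      exact fun z hz hzh => hne ⟨z, by simpa using hz, hzh⟩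

variable {B : X →ₗ[F] X →ₗ[F] F} {u v : X} {a b : F}

/-- The projection onto the orthogonal complement of an orthogonal pair `u, v`. -/
noncomputable def orthProj (B : X →ₗ[F] X →ₗ[F] F) (u v : X) : X →ₗ[F] X :=
  LinearMap.id - ((B u u)⁻¹ • (B u).smulRight u) - ((B v v)⁻¹ • (B v).smulRight v)

theorem orthProj_apply (B : X →ₗ[F] X →ₗ[F] F) (u v x : X) :
    orthProj B u v x = x - ((B u u)⁻¹ * B u x) • u - ((B v v)⁻¹ * B v x) • v := by
  simp [orthProj, mul_smul]

variable (hB : ∀ x y, B x y = B y x) (hu : B u u ≠ 0) (hv : B v v ≠ 0) (huv : B u v = 0)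
include hB hu hv huv

omit hB in
theorem form_orthProj_left (x : X) : B u (orthProj B u v x) = 0 := by
  rw [orthProj_apply]
  simp only [map_sub, map_smul, smul_eq_mul, huv]
  field_simp
  ring

theorem form_orthProj_right (x : X) : B v (orthProj B u v x) = 0 := by
  rw [orthProj_apply]
  simp only [map_sub, map_smul, smul_eq_mul, hB v u, huv]
  field_simp
  ring

theorem form_combination (s t : F) (x : X) :
    B (s • u + t • v + orthProj B u v x) (s • u + t • v + orthProj B u v x) =
      B u u * s ^ 2 + B v v * t ^ 2 + B (orthProj B u v x) (orthProj B u v x) := by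
  have h1 := form_orthProj_left hu hv huv x
  have h2 := form_orthProj_right hB hu hv huv x
  have h1' := hB (orthProj B u v x) u
  have h2' := hB (orthProj B u v x) v
  rw [h1] at h1'
  rw [h2] at h2'
  simp only [map_add, map_smul, LinearMap.add_apply, LinearMap.smul_apply, smul_eq_mul, h1, h2,
    h1', h2', huv, hB v u]
  ring

theorem linearIndependent_of_orthogonal : LinearIndependent F ![u, v] := by
  rw [LinearIndependent.pair_iff]
  intro s t h
  have e1 := congrArg (B u) h
  have e2 := congrArg (B v) h
  simp only [map_add, map_smul, smul_eq_mul, huv, hB v u, map_zero, mul_zero, add_zero,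
    zero_add] at e1 e2
  exact ⟨by simpa [hu] using e1, by simpa [hv] using e2⟩

theorem mem_formOrbit_of_det [FiniteDimensional F X] {z : Dual F X × Dual F X}
    (hz : z.1 u * z.2 v - z.1 v * z.2 u ≠ 0) :
    (fun x => B u u * z.1 x ^ 2 + B v v * z.2 x ^ 2 +
      B (orthProj B u v x) (orthProj B u v x)) ∈ formOrbit B := by
  let g : X →ₗ[F] X := z.1.smulRight u + z.2.smulRight v + orthProj B u v
  have hg : ∀ x, g x = z.1 x • u + z.2 x • v + orthProj B u v x := fun x => rfl
  have hinj : Function.Injective g := by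
    rw [← LinearMap.ker_eq_bot, LinearMap.ker_eq_bot']
    intro x hx
    rw [hg] at hx
    have e1 := congrArg (B u) hx
    have e2 := congrArg (B v) hx
    simp only [map_add, map_smul, smul_eq_mul, huv, hB v u, map_zero, mul_zero, add_zero,
      zero_add, form_orthProj_left hu hv huv, form_orthProj_right hB hu hv huv] at e1 e2
    have h1 : z.1 x = 0 := by simpa [hu] using e1
    have h2 : z.2 x = 0 := by simpa [hv] using e2
    rw [h1, h2, zero_smul, zero_smul, zero_add, zero_add, orthProj_apply] at hx
    set α := (B u u)⁻¹ * B u x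
    set β := (B v v)⁻¹ * B v x
    have hx' : x = α • u + β • v := by rw [← sub_eq_zero, ← hx]; abel
    rw [hx'] at h1 h2
    simp only [map_add, map_smul, smul_eq_mul] at h1 h2
    have hα : α = 0 := mul_right_cancel₀ hz (by linear_combination z.2 v * h1 - z.1 v * h2)
    have hβ : β = 0 := mul_right_cancel₀ hz (by linear_combination z.1 u * h2 - z.2 u * h1)
    rw [hx', hα, hβ, zero_smul, zero_smul, add_zero]
  refine ⟨LinearEquiv.ofInjectiveEndo g hinj, fun x => ?_⟩
  rw [LinearEquiv.coe_ofInjectiveEndo, hg, form_combination hB hu hv huv]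

omit hB hu hv huv

theorem hasDualPair_of_det {z : Dual F X × Dual F X} (hz : z.1 u * z.2 v - z.1 v * z.2 u ≠ 0) :
    HasDualPair z := by
  set d := z.1 u * z.2 v - z.1 v * z.2 u with hd
  refine ⟨(d⁻¹ * z.2 v) • u - (d⁻¹ * z.2 u) • v, (d⁻¹ * z.1 u) • v - (d⁻¹ * z.1 v) • u, ?_⟩
  simp only [map_sub, map_smul, smul_eq_mul]
  refine ⟨?_, ?_, ?_, ?_⟩ <;> field_simp <;> simp only [hd] <;> ring

theorem exists_basis_extending {ι : Type*} {w : ι → X} (h : LinearIndependent F w) :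
    ∃ (κ : Set X) (β : Basis (ι ⊕ κ) F X), ∀ i, β (Sum.inl i) = w i := by
  refine ⟨_, Module.Basis.sumExtend h, fun i => ?_⟩
  simp [Module.Basis.sumExtend]
  rfl

theorem le_ncard_det [Fintype F] [Finite X] (h : LinearIndependent F ![u, v]) {r : ℕ}
    (hr : finrank F X = r + 2) :
    (Fintype.card F ^ 2 - 1) * (Fintype.card F ^ 2 - Fintype.card F) * Fintype.card F ^ (2 * r) ≤
      {z : Dual F X × Dual F X | z.1 u * z.2 v - z.1 v * z.2 u ≠ 0}.ncard := by
  classical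
  have : Module.Finite F X := inferInstance
  have : Finite (Dual F X) := Finite.of_injective (fun f : Dual F X => (f : X → F))
    DFunLike.coe_injective
  obtain ⟨κ, β, hβ⟩ := exists_basis_extending h
  have hfin : Finite (Fin 2 ⊕ κ) := Module.Finite.finite_basis β
  have : Finite κ := Finite.of_injective (Sum.inr : κ → Fin 2 ⊕ κ) Sum.inr_injective
  have := Fintype.ofFinite κ
  have hκ : Fintype.card κ = r := by
    have := Module.finrank_eq_card_basis β
    rw [hr, Fintype.card_sum, Fintype.card_fin] at this
    change r + 2 = 2 + _ at this
    omega
  let Φ : GL (Fin 2) F × ((κ → F) × (κ → F)) → Dual F X × Dual F X := fun m =>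
    (β.constr F (Sum.elim (fun j => m.1.1 0 j) m.2.1), β.constr F (Sum.elim (fun j => m.1.1 1 j) m.2.2))
  have hΦ : Function.Injective Φ := by
    intro m m' e
    simp only [Φ, Prod.mk.injEq, EmbeddingLike.apply_eq_iff_eq] at e
    obtain ⟨e1, e2⟩ := e
    have f1 := fun i => congrFun e1 (Sum.inl i)
    have f2 := fun i => congrFun e2 (Sum.inl i)
    have f3 := fun i => congrFun e1 (Sum.inr i)
    have f4 := fun i => congrFun e2 (Sum.inr i)
    simp only [Sum.elim_inl, Sum.elim_inr] at f1 f2 f3 f4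
    refine Prod.ext (Units.ext (Matrix.ext fun i j => ?_)) (Prod.ext (funext f3) (funext f4))
    fin_cases i
    · exact f1 j
    · exact f2 j
  have hmaps : ∀ m, Φ m ∈ {z : Dual F X × Dual F X | z.1 u * z.2 v - z.1 v * z.2 u ≠ 0} := by
    intro m
    have hu : u = β (Sum.inl 0) := by rw [hβ]; rfl
    have hv : v = β (Sum.inl 1) := by rw [hβ]; rfl
    change _ ≠ _
    simp only [Φ]
    rw [hu, hv]
    simp only [Module.Basis.constr_basis, Sum.elim_inl]
    have := (Matrix.isUnit_iff_isUnit_det _).mp m.1.isUnit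
    rw [Matrix.det_fin_two] at this
    exact this.ne_zero
  have hle : Nat.card (GL (Fin 2) F × ((κ → F) × (κ → F))) ≤
      {z : Dual F X × Dual F X | z.1 u * z.2 v - z.1 v * z.2 u ≠ 0}.ncard := by
    rw [← Set.ncard_univ]
    exact Set.ncard_le_ncard_of_injOn Φ (fun m _ => hmaps m) hΦ.injOn (Set.toFinite _)
  refine le_trans (le_of_eq ?_) hle
  rw [Nat.card_prod, Matrix.card_GL_field, Nat.card_prod, Nat.card_fun,
    Nat.card_eq_fintype_card (α := κ), hκ, Nat.card_eq_fintype_card (α := F)]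
  simp [Fin.prod_univ_two, two_mul, pow_add]

theorem hasDualPair_of_linearIndependent [FiniteDimensional F X] {ξ η : Dual F X}
    (h : LinearIndependent F ![ξ, η]) : HasDualPair (ξ, η) := by
  obtain ⟨κ, β, hβ⟩ := exists_basis_extending h
  classical
  have hfin : Finite (Fin 2 ⊕ κ) := Module.Finite.finite_basis β
  have := Fintype.ofFinite (Fin 2 ⊕ κ)
  have hx : ∀ i, ∃ x : X, ∀ f : Dual F X, f x = β.coord i f := fun i => by
    refine ⟨(Module.evalEquiv F X).symm (β.coord i), fun f => ?_⟩
    rw [Module.apply_evalEquiv_symm_apply]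
  have e0 : ξ = β (Sum.inl 0) := by rw [hβ]; rfl
  have e1 : η = β (Sum.inl 1) := by rw [hβ]; rfl
  obtain ⟨x₀, hx₀⟩ := hx (Sum.inl 0)
  obtain ⟨y₀, hy₀⟩ := hx (Sum.inl 1)
  refine ⟨x₀, y₀, ?_, ?_, ?_, ?_⟩ <;> simp [hx₀, hy₀, e0, e1]

theorem exists_substitution [FiniteDimensional F X] {z z' : Dual F X × Dual F X}
    (hz : HasDualPair z) (hz' : HasDualPair z') :
    ∃ g : X ≃ₗ[F] X, ∀ x, z'.1 (g x) = z.1 x ∧ z'.2 (g x) = z.2 x := by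
  have key : ∀ w : Dual F X × Dual F X, HasDualPair w →
      ∃ e : X ≃ₗ[F] (F × F) × LinearMap.ker (w.1.prod w.2), ∀ x, (e x).1 = (w.1 x, w.2 x) := by
    rintro w ⟨x₀, y₀, h1, h2, h3, h4⟩
    have hs : LinearMap.range (w.1.prod w.2) = ⊤ := by
      rw [LinearMap.range_eq_top]
      rintro ⟨s, t⟩
      exact ⟨s • x₀ + t • y₀, by simp [h1, h2, h3, h4]⟩
    obtain ⟨C, hC⟩ := Submodule.exists_isCompl (LinearMap.ker (w.1.prod w.2))
    refine ⟨LinearMap.equivProdOfSurjectiveOfIsCompl (w.1.prod w.2)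
      (Submodule.projectionOnto _ C hC) hs (by simp) (by simpa using hC), fun x => rfl⟩
  obtain ⟨e, he⟩ := key z hz
  obtain ⟨e', he'⟩ := key z' hz'
  have hdim : finrank F (LinearMap.ker (z.1.prod z.2)) =
      finrank F (LinearMap.ker (z'.1.prod z'.2)) := by
    have h1 := e.finrank_eq
    have h2 := e'.finrank_eq
    rw [finrank_prod] at h1 h2
    omega
  let ε := LinearEquiv.ofFinrankEq _ _ hdim
  refine ⟨e.trans (((LinearEquiv.refl F (F × F)).prodCongr ε).trans e'.symm), fun x => ?_⟩
  have := he' (e'.symm (((LinearEquiv.refl F (F × F)).prodCongr ε) (e x)))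
  rw [LinearEquiv.apply_symm_apply] at this
  have h2 : (((LinearEquiv.refl F (F × F)).prodCongr ε) (e x)).1 = (e x).1 := rfl
  rw [h2, he x, Prod.mk.injEq] at this
  exact ⟨this.1.symm, this.2.symm⟩

theorem le_ncard_linearIndependent [Fintype F] [Finite X] (h : 2 ≤ finrank F X) :
    (Fintype.card F ^ finrank F X - 1) * (Fintype.card F ^ finrank F X - Fintype.card F) ≤
      {z : Dual F X × Dual F X | LinearIndependent F ![z.1, z.2]}.ncard := by
  have : Module.Finite F X := inferInstance
  have : Finite (Dual F X) := Finite.of_injective (fun f : Dual F X => (f : X → F))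
    DFunLike.coe_injective
  have hd : finrank F (Dual F X) = finrank F X := Subspace.dual_finrank_eq
  have hc := card_linearIndependent (K := F) (V := Dual F X) (k := 2) (by rw [hd]; exact h)
  rw [hd, Fin.prod_univ_two] at hc
  simp only [Fin.val_zero, Fin.val_one, pow_zero, pow_one] at hc
  rw [← hc]
  have hinj : Function.Injective
      (fun s : {s : Fin 2 → Dual F X // LinearIndependent F s} => (s.1 0, s.1 1)) := by
    intro s t e
    simp only [Prod.mk.injEq] at e
    refine Subtype.ext (funext fun i => ?_)
    fin_cases i
    · exact e.1
    · exact e.2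
  rw [← Set.ncard_univ]
  refine Set.ncard_le_ncard_of_injOn _ (fun s _ => ?_) hinj.injOn (Set.toFinite _)
  change LinearIndependent F ![s.1 0, s.1 1]
  have : ![s.1 0, s.1 1] = s.1 := by
    funext i
    fin_cases i <;> rfl
  rw [this]
  exact s.2

theorem orbit_arith {q r O : ℕ} (hq : 2 ≤ q)
    (h : (q ^ 2 - 1) * (q ^ 2 - q) * q ^ (2 * r) ≤ 2 * (q - 1) * O) :
    (q ^ (r + 2) - 1) * (q ^ (r + 2) - q) ≤ 2 * (q + 1) * O := by
  obtain ⟨t, rfl⟩ : ∃ t, q = t + 1 := ⟨q - 1, by omega⟩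
  have ht : 0 < t := by omega
  have e1 : (t + 1) ^ 2 - 1 = t * (t + 2) := by
    rw [Nat.sub_eq_iff_eq_add (Nat.one_le_pow _ _ (by omega))]; ring
  have e2 : (t + 1) ^ 2 - (t + 1) = t * (t + 1) := by
    rw [Nat.sub_eq_iff_eq_add (by nlinarith)]; ring
  rw [e1, e2, Nat.add_sub_cancel] at h
  set Q := (t + 1) ^ r with hQ
  have h' : (t + 2) * (t * (t + 1)) * Q ^ 2 ≤ 2 * O := by
    refine Nat.le_of_mul_le_mul_left ?_ ht
    calc _ = t * (t + 2) * (t * (t + 1)) * (t + 1) ^ (2 * r) := by rw [hQ]; ring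
      _ ≤ _ := h
      _ = _ := by ring
  calc ((t + 1) ^ (r + 2) - 1) * ((t + 1) ^ (r + 2) - (t + 1))
      ≤ (t + 1) ^ (r + 2) * (t + 1) ^ (r + 2) := Nat.mul_le_mul (Nat.sub_le _ _) (Nat.sub_le _ _)
    _ = (t + 1) ^ 3 * ((t + 1) * Q ^ 2) := by rw [hQ]; ring
    _ ≤ ((t + 2) * (t * (t + 2))) * ((t + 1) * Q ^ 2) := by
        refine Nat.mul_le_mul_right _ ?_
        nlinarith
    _ = (t + 2) * ((t + 2) * (t * (t + 1)) * Q ^ 2) := by ring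
    _ ≤ (t + 2) * (2 * O) := Nat.mul_le_mul_left _ h'
    _ = _ := by ring

theorem le_formOrbit_of_isotropic [Fintype F] [Finite X] (h2 : (2 : F) ≠ 0)
    (hB : ∀ x y, B x y = B y x) (hu : B u u ≠ 0) (hv : B v v ≠ 0) (huv : B u v = 0) {r : ℕ}
    (hr : finrank F X = r + 2) {m : F} (hm : B u u + B v v * m ^ 2 = 0) :
    (Fintype.card F ^ (r + 2) - 1) * (Fintype.card F ^ (r + 2) - Fintype.card F) ≤
      2 * (Fintype.card F + 1) * (formOrbit B).ncard := by
  have : Module.Finite F X := inferInstance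
  refine orbit_arith Fintype.one_lt_card ?_
  refine (le_ncard_det (linearIndependent_of_orthogonal hB hu hv huv) hr).trans ?_
  refine (ncard_le_mul_ncard_formOrbit B h2 hu hv
    (fun x => B (orthProj B u v x) (orthProj B u v x)) _
    (fun z hz => hasDualPair_of_det hz) fun z hz => mem_formOrbit_of_det hB hu hv huv hz).trans ?_
  gcongr
  exact ncard_conic_le_of_isotropic h2 hu hv hm

/-- A quadratic form of rank at least two has a large orbit under linear substitutions. -/
theorem le_formOrbit [Fintype F] [Finite X] (h2 : (2 : F) ≠ 0)
    (hB : ∀ x y, B x y = B y x) (hu : B u u ≠ 0) (hv : B v v ≠ 0) (huv : B u v = 0) {r : ℕ}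
    (hr : finrank F X = r + 2) :
    (Fintype.card F ^ (r + 2) - 1) * (Fintype.card F ^ (r + 2) - Fintype.card F) ≤
      2 * (Fintype.card F + 1) * (formOrbit B).ncard := by
  have : Module.Finite F X := inferInstance
  by_cases hz : ∃ x, B (orthProj B u v x) (orthProj B u v x) ≠ 0
  · obtain ⟨x, hx⟩ := hz
    set z := orthProj B u v x with hzdef
    obtain ⟨p, s, hps⟩ : ∃ p s : F, B u u * p ^ 2 + B v v * s ^ 2 = -B z z := by
      have hodd : Fintype.card F % 2 = 1 := FiniteField.odd_card_of_char_ne_two fun h => h2 (by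
        have : CharP F 2 := ringChar.of_eq h
        exact CharTwo.two_eq_zero)
      obtain ⟨p, s, h⟩ := FiniteField.exists_root_sum_quadratic
        (f := Polynomial.C (B u u) * Polynomial.X ^ 2 + Polynomial.C 0 * Polynomial.X +
          Polynomial.C (B z z))
        (g := Polynomial.C (B v v) * Polynomial.X ^ 2 + Polynomial.C 0 * Polynomial.X +
          Polynomial.C 0)
        (Polynomial.degree_quadratic hu) (Polynomial.degree_quadratic hv) hodd
      refine ⟨p, s, ?_⟩
      simp at h
      linear_combination h
    have hw := form_combination hB hu hv huv p s 0
    simp only [map_zero, add_zero, hps] at hw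
    have hwz : B (p • u + s • v) z = 0 := by
      simp [hzdef, form_orthProj_left hu hv huv, form_orthProj_right hB hu hv huv]
    exact le_formOrbit_of_isotropic h2 hB (by rw [hw]; simpa using hx) hx hwz hr (m := 1)
      (by rw [hw]; ring)
  · push Not at hz
    rw [← hr]
    refine (le_ncard_linearIndependent (by omega)).trans ?_
    refine (ncard_le_mul_ncard_formOrbit B h2 hu hv (fun _ => 0) _
      (fun z hz' => hasDualPair_of_linearIndependent hz') fun z hz' => ?_).trans ?_
    · let ξ₀ : Dual F X := (B u u)⁻¹ • B u
      let η₀ : Dual F X := (B v v)⁻¹ • B v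
      have h0 : HasDualPair (ξ₀, η₀) := by
        refine ⟨u, v, ?_, ?_, ?_, ?_⟩ <;> simp [ξ₀, η₀, huv, hB v u, hu, hv]
      obtain ⟨g, hg⟩ := exists_substitution (hasDualPair_of_linearIndependent hz') h0
      refine ⟨g, fun x => ?_⟩
      have e := form_combination hB hu hv huv (ξ₀ (g x)) (η₀ (g x)) (g x)
      have e' : ξ₀ (g x) • u + η₀ (g x) • v + orthProj B u v (g x) = g x := by
        rw [orthProj_apply]
        simp only [ξ₀, η₀, LinearMap.smul_apply, smul_eq_mul]
        abel
      rw [e', hz, (hg x).1, (hg x).2] at e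
      exact e.symm
    · gcongr
      exact ncard_conic_le h2 hu hv

end OrbitBound

section SmallRank

variable {r : ℕ} {F : Type*} [Field F]

/-- The unipotent element `(x, y) ↦ (x + (M + Mᵀ) y, y)`. -/
def unip (M : Matrix (Fin r) (Fin r) F) : Sp r F :=
  ⟨fromBlocks 1 (M + Mᵀ) 0 1, by
    rw [SymplecticGroup.mem_iff]
    simp [fromBlocks_multiply, J, fromBlocks_transpose, add_comm]
    abel⟩

theorem act_unip (M : Matrix (Fin r) (Fin r) F) (x y : Fin r → F) :
    act (unip M) (Sum.elim x y) = Sum.elim (x + (M + Mᵀ) *ᵥ y) y := by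
  simp only [act, unip, mulVecLin_apply, fromBlocks_mulVec]
  simp

/-- The Levi element `(x, y) ↦ (A x, (A⁻¹)ᵀ y)`. -/
def levi (A A' : Matrix (Fin r) (Fin r) F) (h : A * A' = 1) : Sp r F :=
  ⟨fromBlocks A 0 0 A'ᵀ, by
    have h' : A' * A = 1 := _root_.mul_eq_one_comm.mp h
    rw [SymplecticGroup.mem_iff]
    simp [fromBlocks_multiply, J, fromBlocks_transpose, h, ← transpose_mul]⟩

theorem act_levi (A A' : Matrix (Fin r) (Fin r) F) (h : A * A' = 1) (x y : Fin r → F) :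
    act (levi A A' h) (Sum.elim x y) = Sum.elim (A *ᵥ x) (A'ᵀ *ᵥ y) := by
  simp only [act, levi, mulVecLin_apply, fromBlocks_mulVec]
  simp

theorem act_ext_elim {g h : Sp r F}
    (H : ∀ x y, act g (Sum.elim x y) = act h (Sum.elim x y)) : g = h :=
  act_ext fun z => by rw [← Sum.elim_comp_inl_inr z]; exact H _ _

theorem unip_zero : unip (0 : Matrix (Fin r) (Fin r) F) = 1 :=
  act_ext_elim fun x y => by simp [act_unip]

theorem unip_add (M N : Matrix (Fin r) (Fin r) F) : unip (M + N) = unip M * unip N :=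
  act_ext_elim fun x y => by
    simp only [act_mul, act_unip, transpose_add, add_mulVec]
    congr 1
    abel

theorem unip_transpose (M : Matrix (Fin r) (Fin r) F) : unip Mᵀ = unip M :=
  act_ext_elim fun x y => by simp only [act_unip, transpose_transpose, add_comm Mᵀ]

theorem levi_mul_unip {A A' : Matrix (Fin r) (Fin r) F} (h : A * A' = 1)
    (M : Matrix (Fin r) (Fin r) F) :
    levi A A' h * unip M = unip (A * M * Aᵀ) * levi A A' h :=
  act_ext_elim fun x y => by
    have h' : Aᵀ * A'ᵀ = 1 := by rw [← transpose_mul, _root_.mul_eq_one_comm.mp h, transpose_one]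
    have e : (A * M * Aᵀ + (A * M * Aᵀ)ᵀ) * A'ᵀ = A * (M + Mᵀ) := by
      simp only [transpose_mul, transpose_transpose, Matrix.add_mul, Matrix.mul_add,
        Matrix.mul_assoc, h', Matrix.mul_one]
    simp only [act_mul, act_unip, act_levi, mulVec_add, mulVec_mulVec, e]

theorem siegel_elim_zero (x y : Fin r → F) :
    siegel (Sum.elim x 0) (Sum.elim y 0) = unip (vecMulVec x y) :=
  act_ext_elim fun z w => by
    rw [act_siegel (by simp [form_sumElim]), act_unip]
    simp only [form_sumElim]
    funext i
    rcases i with i | i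
    · simp [vecMulVec, mulVec, dotProduct, Finset.sum_add_distrib, add_mul, Finset.sum_mul]
      rw [add_assoc, add_comm (∑ _, _)]
      congr 2 <;> exact Finset.sum_congr rfl fun _ _ => by ring
    · simp

theorem transv_elim_zero (h2 : (2 : F) ≠ 0) (x : Fin r → F) (c : F) :
    transv (Sum.elim x 0) c = unip (vecMulVec x ((c / 2) • x)) := by
  rw [← siegel_elim_zero]
  have e : (Sum.elim ((c / 2) • x) 0 : Vec r F) = (c / 2) • Sum.elim x 0 := by
    funext i; rcases i with i | i <;> simp
  refine act_ext fun z => ?_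
  rw [e, act_siegel (by simp), act_transv, map_smul, smul_smul, smul_eq_mul, add_assoc, ← add_smul]
  congr 2
  field_simp
  ring

theorem exists_orthogonal_pair {X : Type*} [AddCommGroup X] [Module F X] (h2 : (2 : F) ≠ 0)
    {B : X →ₗ[F] X →ₗ[F] F}
    (hB : ∀ x y, B x y = B y x) {u v : X} (h : B u u * B v v ≠ B u v ^ 2) :
    ∃ u' v', B u' u' ≠ 0 ∧ B v' v' ≠ 0 ∧ B u' v' = 0 := by
  have step : ∀ u v : X, B u u * B v v ≠ B u v ^ 2 → B u u ≠ 0 →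
      ∃ u' v', B u' u' ≠ 0 ∧ B v' v' ≠ 0 ∧ B u' v' = 0 := by
    intro u v h ha
    refine ⟨u, B u u • v - B u v • u, ha, ?_, ?_⟩
    · have : B (B u u • v - B u v • u) (B u u • v - B u v • u) =
          B u u * (B u u * B v v - B u v ^ 2) := by
        simp only [map_sub, map_smul, LinearMap.sub_apply, LinearMap.smul_apply, smul_eq_mul,
          hB v u]
        ring
      rw [this]
      exact mul_ne_zero ha (sub_ne_zero.mpr h)
    · simp only [map_sub, map_smul, smul_eq_mul]
      ring
  by_cases ha : B u u = 0
  · by_cases hd : B v v = 0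
    · have hb : B u v ≠ 0 := by
        rintro h0
        simp [ha, h0] at h
      refine ⟨u + v, u - v, ?_, ?_, ?_⟩ <;>
        simp only [map_sub, map_add, LinearMap.sub_apply, LinearMap.add_apply, ha, hd, hB v u]
      · rw [show (0 : F) + B u v + (B u v + 0) = 2 * B u v by ring]
        exact mul_ne_zero h2 hb
      · rw [show (0 : F) - B u v - (B u v - 0) = -(2 * B u v) by ring]
        exact neg_ne_zero.mpr (mul_ne_zero h2 hb)
      · ring
    · exact step v u (by rwa [mul_comm, hB v u]) hd
  · exact step u v h ha

variable {k V : Type*} [Field k] [AddCommGroup V] [Module k V]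

/-- The bilinear form attached to a functional on matrices. -/
def dualForm (f : Dual F (Matrix (Fin r) (Fin r) F)) :
    (Fin r → F) →ₗ[F] (Fin r → F) →ₗ[F] F :=
  LinearMap.mk₂ F (fun x y => f (vecMulVec x y))
    (fun x x' y => by rw [add_vecMulVec, map_add])
    (fun c x y => by rw [smul_vecMulVec, map_smul])
    (fun x y y' => by rw [vecMulVec_add, map_add])
    (fun c x y => by rw [vecMulVec_smul, map_smul])

theorem dualForm_apply (f : Dual F (Matrix (Fin r) (Fin r) F)) (x y : Fin r → F) :
    dualForm f x y = f (vecMulVec x y) := rfl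

variable {ψ : AddChar F k} {ρ : Sp r F →* (V →ₗ[k] V)}

theorem dualForm_symm (hψ : ψ ≠ 1) {f : Dual F (Matrix (Fin r) (Fin r) F)}
    (hf : weightSpace ψ (fun M => ρ (unip M)) f ≠ ⊥) (x y : Fin r → F) :
    dualForm f x y = dualForm f y x := by
  obtain ⟨v, hv, hv0⟩ := Submodule.exists_mem_ne_zero_of_ne_bot hf
  by_contra hne
  have hd : dualForm f x y - dualForm f y x ≠ 0 := sub_ne_zero.mpr hne
  obtain ⟨a, ha⟩ := (AddChar.ne_one_iff).mp hψ
  apply ha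
  have e : ∀ c : F, ψ (c * dualForm f x y) = ψ (c * dualForm f y x) := by
    intro c
    have h1 := hv (c • vecMulVec x y)
    have h2 := hv (c • vecMulVec x y)ᵀ
    simp only [unip_transpose] at h2
    rw [h1] at h2
    have := smul_left_injective k hv0 h2
    simpa [transpose_smul, transpose_vecMulVec, dualForm_apply] using this
  have := e (a / (dualForm f x y - dualForm f y x))
  have hne2 : ψ (a / (dualForm f x y - dualForm f y x) * dualForm f y x) ≠ 0 := by
    intro h0
    have h3 := ψ.map_add_eq_mul (a / (dualForm f x y - dualForm f y x) * dualForm f y x)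
      (-(a / (dualForm f x y - dualForm f y x) * dualForm f y x))
    rw [h0, add_neg_cancel, zero_mul, AddChar.map_zero_eq_one] at h3
    exact one_ne_zero h3
  have e2 : a = a / (dualForm f x y - dualForm f y x) * dualForm f x y -
      a / (dualForm f x y - dualForm f y x) * dualForm f y x := by
    rw [← mul_sub, div_mul_cancel₀ _ hd]
  apply mul_right_cancel₀ hne2
  rw [← AddChar.map_add_eq_mul, one_mul, ← this]
  congr 1
  linear_combination e2

/-- The functional `M ↦ f (A M Aᵀ)`. -/
def twist (f : Dual F (Matrix (Fin r) (Fin r) F)) (A : Matrix (Fin r) (Fin r) F) :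
    Dual F (Matrix (Fin r) (Fin r) F) :=
  f ∘ₗ (LinearMap.mulRight F Aᵀ) ∘ₗ LinearMap.mulLeft F A

theorem twist_apply (f : Dual F (Matrix (Fin r) (Fin r) F)) (A M : Matrix (Fin r) (Fin r) F) :
    twist f A M = f (A * M * Aᵀ) := rfl

theorem weightSpace_twist_ne_bot {f : Dual F (Matrix (Fin r) (Fin r) F)}
    (hf : weightSpace ψ (fun M => ρ (unip M)) f ≠ ⊥) {A A' : Matrix (Fin r) (Fin r) F}
    (h : A * A' = 1) : weightSpace ψ (fun M => ρ (unip M)) (twist f A) ≠ ⊥ := by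
  obtain ⟨v, hv, hv0⟩ := Submodule.exists_mem_ne_zero_of_ne_bot hf
  refine Submodule.ne_bot_iff _ |>.mpr ⟨ρ (levi A A' h)⁻¹ v, fun M => ?_, fun h0 => hv0 ?_⟩
  · have e : unip M * (levi A A' h)⁻¹ = (levi A A' h)⁻¹ * unip (A * M * Aᵀ) := by
      rw [eq_inv_mul_iff_mul_eq, ← mul_assoc, levi_mul_unip, mul_assoc, mul_inv_cancel, mul_one]
    change ρ (unip M) (ρ (levi A A' h)⁻¹ v) = _
    rw [← Module.End.mul_apply, ← map_mul, e, map_mul, Module.End.mul_apply, twist_apply, ← map_smul]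
    congr 1
    exact hv _
  · have : ρ (levi A A' h) (ρ (levi A A' h)⁻¹ v) = v := by
      rw [← Module.End.mul_apply, ← map_mul, mul_inv_cancel, map_one, Module.End.one_apply]
    rw [← this, h0, map_zero]

theorem ncard_formOrbit_le_finrank [Finite F] [FiniteDimensional k V] (hψ : ψ ≠ 1)
    (hF : (Nat.card F : k) ≠ 0) {f : Dual F (Matrix (Fin r) (Fin r) F)}
    (hf : weightSpace ψ (fun M => ρ (unip M)) f ≠ ⊥) :
    (formOrbit (dualForm f)).ncard ≤ finrank k V := by
  classical
  have hX : (Nat.card (Matrix (Fin r) (Fin r) F) : k) ≠ 0 := by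
    have : Nat.card (Matrix (Fin r) (Fin r) F) = (Nat.card F ^ r) ^ r := by
      change Nat.card (Fin r → Fin r → F) = _
      rw [Nat.card_fun, Nat.card_fun, Nat.card_eq_fintype_card (α := Fin r), Fintype.card_fin]
    rw [this]
    push_cast
    exact pow_ne_zero _ (pow_ne_zero _ hF)
  have : Finite (Matrix (Fin r) (Fin r) F) := inferInstanceAs (Finite (Fin r → Fin r → F))
  have hind := iSupIndep_weightSpace (X := Matrix (Fin r) (Fin r) F)
    (R := fun M => ρ (unip M)) hψ hX
  have : Finite (Dual F (Matrix (Fin r) (Fin r) F)) := Module.finite_of_finite F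
  have := Fintype.ofFinite {i // weightSpace ψ (fun M => ρ (unip M)) i ≠ ⊥}
  refine le_trans ?_ hind.subtype_ne_bot_le_finrank
  rw [← Nat.card_eq_fintype_card]
  choose g hg using fun h : formOrbit (dualForm f) => h.2
  let A : ((Fin r → F) ≃ₗ[F] (Fin r → F)) → Matrix (Fin r) (Fin r) F := fun e =>
    LinearMap.toMatrix' e.toLinearMap
  have hA : ∀ e, A e * A e.symm = 1 := fun e => by
    rw [← LinearMap.toMatrix'_comp]
    simp
  have hmul : ∀ e x, A e *ᵥ x = e x := fun e x => by simp [A, LinearMap.toMatrix'_mulVec]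
  refine Nat.card_le_card_of_injective
    (fun h => (⟨twist f (A (g h)), weightSpace_twist_ne_bot hf (hA _)⟩ :
      {i // weightSpace ψ (fun M => ρ (unip M)) i ≠ ⊥})) ?_
  intro h h' e
  refine Subtype.ext (funext fun x => ?_)
  have e1 := congrArg (fun i => i.1 (vecMulVec x x)) e
  simp only [twist_apply, mul_vecMulVec, vecMulVec_mul, vecMul_transpose, hmul] at e1
  rw [hg h x, hg h' x]
  exact e1

theorem dualForm_mul_self [Fintype F] [FiniteDimensional k V] (h2 : (2 : F) ≠ 0) (hψ : ψ ≠ 1)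
    (hF : (Fintype.card F : k) ≠ 0) (hr : 2 ≤ r)
    (hsmall : 2 * (Fintype.card F + 1) * finrank k V <
      (Fintype.card F ^ r - 1) * (Fintype.card F ^ r - Fintype.card F))
    {f : Dual F (Matrix (Fin r) (Fin r) F)}
    (hf : weightSpace ψ (fun M => ρ (unip M)) f ≠ ⊥) (x y : Fin r → F) :
    dualForm f x x * dualForm f y y = dualForm f x y ^ 2 := by
  by_contra hne
  obtain ⟨u, v, hu, hv, huv⟩ := exists_orthogonal_pair h2 (dualForm_symm hψ hf) hne
  obtain ⟨s, rfl⟩ := Nat.exists_eq_add_of_le' hr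
  have := le_formOrbit h2 (dualForm_symm hψ hf) hu hv huv (r := s) (by simp)
  have h' := ncard_formOrbit_le_finrank hψ (by rwa [Nat.card_eq_fintype_card]) hf
  exact absurd (this.trans (Nat.mul_le_mul_left _ h')) (not_le.mpr hsmall)

end SmallRank

section PairWeights

variable {r : ℕ} {F k V : Type*} [Field F] [Field k] [AddCommGroup V] [Module k V]

/-- The subspace on which the transvections along `u` act through `c ↦ ψ (a c)`. -/
def lineWeight (ψ : AddChar F k) (ρ : Sp r F →* (V →ₗ[k] V)) (u : Vec r F) (a : F) :
    Submodule k V where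
  carrier := {x | ∀ c, ρ (transv u c) x = ψ (a * c) • x}
  add_mem' ha hb c := by rw [map_add, ha c, hb c, smul_add]
  zero_mem' c := by simp
  smul_mem' t v hv c := by rw [map_smul, hv c, smul_comm]

/-- The joint weight spaces of the unipotent group attached to an orthogonal pair. -/
def pairWeight (ψ : AddChar F k) (ρ : Sp r F →* (V →ₗ[k] V)) (u v : Vec r F) (a b d : F) :
    Submodule k V where
  carrier := {x | x ∈ lineWeight ψ ρ u a ∧ x ∈ lineWeight ψ ρ v d ∧
    ∀ c, ρ (siegel u (c • v)) x = ψ (2 * b * c) • x}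
  add_mem' ha hb := ⟨add_mem ha.1 hb.1, add_mem ha.2.1 hb.2.1, fun c => by
    rw [map_add, ha.2.2 c, hb.2.2 c, smul_add]⟩
  zero_mem' := ⟨zero_mem _, zero_mem _, fun c => by simp⟩
  smul_mem' t v hv := ⟨Submodule.smul_mem _ _ hv.1, Submodule.smul_mem _ _ hv.2.1, fun c => by
    rw [map_smul, hv.2.2 c, smul_comm]⟩

/-- The weights of every pair of orthogonal vectors have rank at most one. -/
def SmallRank (ψ : AddChar F k) (ρ : Sp r F →* (V →ₗ[k] V)) : Prop :=
  ∀ u v : Vec r F, ω u v = 0 → ∀ W : Submodule k V,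
    (∀ a b d, a * d = b ^ 2 → pairWeight ψ ρ u v a b d ≤ W) → W = ⊤

variable {ψ : AddChar F k} {ρ : Sp r F →* (V →ₗ[k] V)}

theorem rep_mul_apply (ρ : Sp r F →* (V →ₗ[k] V)) (g h : Sp r F) (x : V) :
    ρ (g * h) x = ρ g (ρ h x) := by
  rw [map_mul, Module.End.mul_apply]

theorem rep_inv_apply (ρ : Sp r F →* (V →ₗ[k] V)) (g : Sp r F) (x : V) :
    ρ g (ρ g⁻¹ x) = x := by
  rw [← rep_mul_apply, mul_inv_cancel, map_one, Module.End.one_apply]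

theorem rep_apply_inv (ρ : Sp r F →* (V →ₗ[k] V)) (g : Sp r F) (x : V) :
    ρ g⁻¹ (ρ g x) = x := by
  rw [← rep_mul_apply, inv_mul_cancel, map_one, Module.End.one_apply]

theorem rep_conj_apply (ρ : Sp r F →* (V →ₗ[k] V)) (g h : Sp r F) (x : V) :
    ρ (g * h * g⁻¹) (ρ g x) = ρ g (ρ h x) := by
  rw [rep_mul_apply, rep_mul_apply, rep_apply_inv]

theorem rep_mem_lineWeight {u : Vec r F} {a : F} {x : V} (g : Sp r F)
    (hx : x ∈ lineWeight ψ ρ u a) : ρ g x ∈ lineWeight ψ ρ (act g u) a := fun c => by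
  rw [← conj_transv, rep_conj_apply, hx c, map_smul]

theorem rep_mem_pairWeight {u v : Vec r F} {a b d : F} {x : V} (g : Sp r F)
    (hx : x ∈ pairWeight ψ ρ u v a b d) : ρ g x ∈ pairWeight ψ ρ (act g u) (act g v) a b d :=
  ⟨rep_mem_lineWeight g hx.1, rep_mem_lineWeight g hx.2.1, fun c => by
    rw [← map_smul (act g), ← conj_siegel, rep_conj_apply, hx.2.2 c, map_smul]⟩

theorem eq_top_of_lineWeight_le [Fintype F] (hψ : ψ ≠ 1) (hF : (Fintype.card F : k) ≠ 0)
    (u : Vec r F) {W : Submodule k V} (h : ∀ a, lineWeight ψ ρ u a ≤ W) : W = ⊤ := by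
  rw [← Nat.card_eq_fintype_card] at hF
  rw [eq_top_iff, ← iSup_weightSpace (X := F) (R := fun c => ρ (transv u c)) hψ hF
    (by simp [transv_zero_right]) (fun x y => by rw [transv_add_right, map_mul])]
  refine iSup_le fun f => ?_
  intro x hx
  refine h (f 1) fun c => ?_
  have := hx c
  have e : f c = f 1 * c := by
    have := f.map_smul c 1
    simp only [smul_eq_mul, mul_one] at this
    rw [this, mul_comm]
  rw [this, e]

theorem siegel_smul_comm {u v : Vec r F} (h : ω u v = 0) (c : F) :
    siegel u (c • v) = siegel v (c • u) := by
  have h' : ω v u = 0 := by rw [form_neg_swap, h, neg_zero]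
  refine act_ext fun x => ?_
  rw [act_siegel (by rw [map_smul, h, smul_zero]), act_siegel (by rw [map_smul, h', smul_zero]),
    map_smul, map_smul]
  module

theorem siegel_self_smul (u : Vec r F) (c : F) : siegel u (c • u) = transv u (2 * c) := by
  refine act_ext fun x => ?_
  rw [act_siegel (by simp), act_transv, map_smul]
  module

theorem pairWeight_comm {u v : Vec r F} (h : ω u v = 0) (a b d : F) :
    pairWeight ψ ρ u v a b d ≤ pairWeight ψ ρ v u d b a := fun x hx =>
  ⟨hx.2.1, hx.1, fun c => by rw [← siegel_smul_comm h]; exact hx.2.2 c⟩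

theorem lineWeight_le_pairWeight_smul (u : Vec r F) (s a : F) :
    lineWeight ψ ρ u a ≤ pairWeight ψ ρ u (s • u) a (a * s) (a * s ^ 2) := fun x hx =>
  ⟨hx, fun c => by rw [transv_smul, hx]; ring_nf, fun c => by
    rw [smul_smul, siegel_self_smul, hx]; ring_nf⟩

theorem smallRank_of_finrank_lt [Fintype F] [FiniteDimensional k V] (h2 : (2 : F) ≠ 0)
    (hψ : ψ ≠ 1) (hF : (Fintype.card F : k) ≠ 0) (hr : 2 ≤ r)
    (hsmall : 2 * (Fintype.card F + 1) * finrank k V <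
      (Fintype.card F ^ r - 1) * (Fintype.card F ^ r - Fintype.card F)) : SmallRank ψ ρ := by
  have dep : ∀ (u : Vec r F) (s : F) (W : Submodule k V),
      (∀ a b d, a * d = b ^ 2 → pairWeight ψ ρ u (s • u) a b d ≤ W) → W = ⊤ :=
    fun u s W hW => eq_top_of_lineWeight_le (ρ := ρ) hψ hF u fun a =>
      (lineWeight_le_pairWeight_smul u s a).trans (hW _ _ _ (by ring))
  intro u v huv W hW
  by_cases hli : LinearIndependent F ![u, v]
  · let e₀ : Fin r → F := Pi.single ⟨0, by omega⟩ 1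
    let e₁ : Fin r → F := Pi.single ⟨1, by omega⟩ 1
    have hli' : LinearIndependent F ![(Sum.elim e₀ 0 : Vec r F), Sum.elim e₁ 0] := by
      rw [LinearIndependent.pair_iff]
      intro s t h
      have h0 := congrFun h (Sum.inl ⟨0, by omega⟩)
      have h1 := congrFun h (Sum.inl ⟨1, by omega⟩)
      simp [e₀, e₁] at h0 h1
      exact ⟨h0, h1⟩
    obtain ⟨g, hgu, hgv⟩ := exists_act_pair hli' hli (by rw [huv]; simp [form_sumElim])
    have hX : (Nat.card (Matrix (Fin r) (Fin r) F) : k) ≠ 0 := by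
      have : Nat.card (Matrix (Fin r) (Fin r) F) = (Nat.card F ^ r) ^ r := by
        change Nat.card (Fin r → Fin r → F) = _
        rw [Nat.card_fun, Nat.card_fun, Nat.card_eq_fintype_card (α := Fin r), Fintype.card_fin]
      rw [this, Nat.card_eq_fintype_card]
      push_cast
      exact pow_ne_zero _ (pow_ne_zero _ hF)
    have : Finite (Matrix (Fin r) (Fin r) F) := inferInstanceAs (Finite (Fin r → Fin r → F))
    have htop : W.comap (ρ g) = ⊤ := by
      rw [eq_top_iff, ← iSup_weightSpace (X := Matrix (Fin r) (Fin r) F)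
        (R := fun M => ρ (unip M)) hψ hX (by simp [unip_zero])
        (fun x y => by rw [unip_add, map_mul])]
      refine iSup_le fun f => ?_
      by_cases hf : weightSpace ψ (fun M => ρ (unip M)) f = ⊥
      · rw [hf]; exact bot_le
      have hsq := dualForm_mul_self h2 hψ hF hr hsmall hf e₀ e₁
      intro x hx
      refine hW (dualForm f e₀ e₀ / 2) (dualForm f e₀ e₁ / 2) (dualForm f e₁ e₁ / 2) ?_ ?_
      · field_simp
        exact hsq
      · rw [← hgu, ← hgv]
        refine rep_mem_pairWeight g ⟨fun c => ?_, fun c => ?_, fun c => ?_⟩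
        · rw [transv_elim_zero h2]
          refine (hx _).trans ?_
          rw [vecMulVec_smul, map_smul, smul_eq_mul, dualForm_apply]
          congr 2
          field_simp
        · rw [transv_elim_zero h2]
          refine (hx _).trans ?_
          rw [vecMulVec_smul, map_smul, smul_eq_mul, dualForm_apply]
          congr 2
          field_simp
        · have e : (c • Sum.elim e₁ 0 : Vec r F) = Sum.elim (c • e₁) 0 := by
            funext i; rcases i with i | i <;> simp
          rw [e, siegel_elim_zero]
          refine (hx _).trans ?_
          rw [vecMulVec_smul, map_smul, smul_eq_mul, dualForm_apply]
          congr 2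
          field_simp
    rw [eq_top_iff]
    intro x _
    have : ρ g⁻¹ x ∈ W.comap (ρ g) := by rw [htop]; trivial
    simpa [rep_inv_apply] using this
  · rw [LinearIndependent.pair_iff] at hli
    push Not at hli
    obtain ⟨s, t, hst, hne⟩ := hli
    by_cases ht : t = 0
    · have hs : s ≠ 0 := fun h => hne h ht
      have hu : u = (0 : F) • v := by
        rw [ht, zero_smul, add_zero] at hst
        rw [zero_smul]
        exact (smul_eq_zero.mp hst).resolve_left hs
      subst hu
      exact dep v 0 W fun a b d h => (pairWeight_comm (by simp) a b d).trans
        (hW d b a (by rw [mul_comm, h]))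
    · have hv : v = (-(t⁻¹ * s)) • u := by
        have : t • v = -(s • u) := by rw [← add_eq_zero_iff_eq_neg, add_comm, hst]
        rw [neg_smul, mul_smul, ← smul_neg, ← this, smul_smul, inv_mul_cancel₀ ht, one_smul]
      subst hv
      exact dep u _ W hW

end PairWeights

section Plane

variable {r : ℕ} {F : Type*} [Field F]

theorem form_swap_zero {u v : Vec r F} (h : ω u v = 0) : ω v u = 0 := by
  rw [form_neg_swap, h, neg_zero]

/-- The symplectic complement of the plane spanned by `v` and `w`. -/
def planeCompl (v w : Vec r F) : Submodule F (Vec r F) where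
  carrier := {u | ω u v = 0 ∧ ω u w = 0}
  add_mem' ha hb := ⟨by simp [ha.1, hb.1], by simp [ha.2, hb.2]⟩
  zero_mem' := ⟨by simp, by simp⟩
  smul_mem' c u hu := ⟨by simp [hu.1], by simp [hu.2]⟩

variable {v w : Vec r F}

theorem exists_planeCompl_add (h : ω v w ≠ 0) (z : Vec r F) :
    ∃ z₁ ∈ planeCompl v w, ∃ z₂, (∀ u ∈ planeCompl v w, ω u z₂ = 0) ∧ z = z₁ + z₂ := by
  refine ⟨z - ((ω z w / ω v w) • v - (ω z v / ω v w) • w), ⟨?_, ?_⟩,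
    (ω z w / ω v w) • v - (ω z v / ω v w) • w, fun u hu => ?_, by abel⟩
  · simp only [map_sub, map_smul, LinearMap.sub_apply, LinearMap.smul_apply, smul_eq_mul,
      form_self, form_neg_swap v w]
    field_simp
    ring
  · simp only [map_sub, map_smul, LinearMap.sub_apply, LinearMap.smul_apply, smul_eq_mul,
      form_self]
    field_simp
    ring
  · simp [hu.1, hu.2]

theorem exists_form_ne_zero_planeCompl (hr : 2 ≤ r) (h : ω v w ≠ 0) :
    ∃ u ∈ planeCompl v w, ∃ u' ∈ planeCompl v w, ω u' u ≠ 0 := by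
  have hker : LinearMap.ker (((form r F).flip v).prod ((form r F).flip w)) ≠ ⊥ := by
    apply LinearMap.ker_ne_bot_of_finrank_lt
    simp
    omega
  obtain ⟨u, hu, hu0⟩ := Submodule.exists_mem_ne_zero_of_ne_bot hker
  simp only [LinearMap.mem_ker, LinearMap.prod_apply, Function.prod_apply, Prod.mk_eq_zero,
    LinearMap.flip_apply] at hu
  have hu' : u ∈ planeCompl v w := hu
  obtain ⟨y, hy⟩ := form_nondegenerate hu0
  obtain ⟨y₁, hy₁, y₂, hy₂, rfl⟩ := exists_planeCompl_add h y
  rw [map_add, hy₂ u hu', add_zero] at hy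
  exact ⟨u, hu', y₁, hy₁, fun h => hy (form_swap_zero h)⟩

end Plane

section Spanning

variable {r : ℕ} {F k V : Type*} [Field F] [Fintype F] [Field k] [AddCommGroup V] [Module k V]
  {ψ : AddChar F k} {ρ : Sp r F →* (V →ₗ[k] V)}

/-- The projection onto `lineWeight ψ ρ u a`. -/
noncomputable def lineProj (ψ : AddChar F k) (ρ : Sp r F →* (V →ₗ[k] V)) (u : Vec r F) (a : F) :
    V →ₗ[k] V :=
  weightProj ψ (fun c => ρ (transv u c)) (a • (LinearMap.id : F →ₗ[F] F))

theorem lineProj_apply (u : Vec r F) (a : F) (x : V) :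
    lineProj ψ ρ u a x = (Fintype.card F : k)⁻¹ • ∑ c, ψ (-(a * c)) • ρ (transv u c) x := by
  simp [lineProj, weightProj]

omit [Fintype F] in
theorem mem_weightSpace_iff {u : Vec r F} {a : F} {x : V} :
    x ∈ weightSpace ψ (fun c => ρ (transv u c)) (a • (LinearMap.id : F →ₗ[F] F)) ↔
      x ∈ lineWeight ψ ρ u a := Iff.rfl

theorem lineProj_mem (u : Vec r F) (a : F) (x : V) : lineProj ψ ρ u a x ∈ lineWeight ψ ρ u a :=
  mem_weightSpace_iff.mp
    (weightProj_mem (fun x y => by rw [transv_add_right, map_mul]) _ _)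

theorem lineProj_of_mem (hF : (Fintype.card F : k) ≠ 0) {u : Vec r F} {a : F} {x : V}
    (hx : x ∈ lineWeight ψ ρ u a) : lineProj ψ ρ u a x = x :=
  weightProj_apply_self hF (mem_weightSpace_iff.mpr hx)

theorem lineProj_of_mem_of_ne (hψ : ψ ≠ 1) {u : Vec r F} {a b : F} {x : V}
    (hx : x ∈ lineWeight ψ ρ u b) (hab : a ≠ b) : lineProj ψ ρ u a x = 0 :=
  weightProj_apply_of_ne hψ (fun h => hab (by simpa using LinearMap.congr_fun h 1))
    (mem_weightSpace_iff.mpr hx)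

theorem rep_lineProj_comm {g : Sp r F} {u : Vec r F} (h : ∀ c, Commute g (transv u c)) (a : F)
    (x : V) : ρ g (lineProj ψ ρ u a x) = lineProj ψ ρ u a (ρ g x) := by
  simp only [lineProj_apply, map_smul, map_sum]
  congr 1
  refine Finset.sum_congr rfl fun c _ => ?_
  rw [← rep_mul_apply, ← rep_mul_apply, h c]

omit [Fintype F] in
theorem rep_mem_lineWeight_of_commute {g : Sp r F} {u : Vec r F}
    (h : ∀ c, Commute g (transv u c)) {a : F} {x : V} (hx : x ∈ lineWeight ψ ρ u a) :
    ρ g x ∈ lineWeight ψ ρ u a := fun c => by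
  rw [← rep_mul_apply, ← h c, rep_mul_apply, hx c, map_smul]

theorem lineProj_mem_of_mem {u z : Vec r F} (h : ω u z = 0) (a : F) {b : F} {x : V}
    (hx : x ∈ lineWeight ψ ρ u b) : lineProj ψ ρ z a x ∈ lineWeight ψ ρ u b := fun c => by
  rw [rep_lineProj_comm (fun c' => transv_commute h _ _), hx c, map_smul]

omit [Fintype F] in
theorem mem_lineWeight_add_smul {v w : Vec r F} (h : ω v w = 0) {a b d : F} {x : V}
    (hx : x ∈ pairWeight ψ ρ v w a b d) (t : F) :
    x ∈ lineWeight ψ ρ (v + t • w) (a + 2 * b * t + d * t ^ 2) := fun c => by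
  rw [transv_add_left (by rw [map_smul, h, smul_zero]), rep_mul_apply, rep_mul_apply, transv_smul,
    smul_smul, hx.2.1, map_smul, map_smul, hx.1, map_smul, hx.2.2, smul_smul, smul_smul,
    ← AddChar.map_add_eq_mul, ← AddChar.map_add_eq_mul]
  congr 2
  ring

theorem lineProj_lineProj_eq_zero (hψ : ψ ≠ 1) (hF : (Fintype.card F : k) ≠ 0)
    (hS : SmallRank ψ ρ) {u z : Vec r F} (huz : ω u z = 0) {a b : F} (hab : ¬ IsSquare (b * a))
    {x : V} (hx : x ∈ lineWeight ψ ρ u b) : lineProj ψ ρ z a x = 0 := by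
  have key : LinearMap.ker (lineProj ψ ρ z a ∘ₗ lineProj ψ ρ u b) = ⊤ := by
    refine hS u z huz _ fun α β δ hαδ y hy => ?_
    rw [LinearMap.mem_ker, LinearMap.comp_apply]
    by_cases h1 : b = α
    · rw [h1, lineProj_of_mem hF hy.1]
      refine lineProj_of_mem_of_ne hψ hy.2.1 ?_
      rintro rfl
      exact hab ⟨β, by rw [h1, hαδ, pow_two]⟩
    · rw [lineProj_of_mem_of_ne hψ hy.1 h1, map_zero]
  have := LinearMap.congr_fun (LinearMap.ker_eq_top.mp key) x
  rwa [LinearMap.comp_apply, lineProj_of_mem hF hx] at this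

/-- The span of the weight spaces with weight in `S` along vectors in the complement of the plane
`⟨v, w⟩`. -/
def planeSpan (ψ : AddChar F k) (ρ : Sp r F →* (V →ₗ[k] V)) (v w : Vec r F) (S : Set F) :
    Submodule k V :=
  ⨆ u ∈ planeCompl v w, ⨆ a ∈ S, lineWeight ψ ρ u a

omit [Fintype F] in
theorem lineWeight_le_planeSpan {v w u : Vec r F} (hu : u ∈ planeCompl v w) {S : Set F} {a : F}
    (ha : a ∈ S) : lineWeight ψ ρ u a ≤ planeSpan ψ ρ v w S :=
  le_trans (le_iSup₂_of_le a ha le_rfl) (le_iSup₂_of_le (f := fun u _ => ⨆ a ∈ S, lineWeight ψ ρ u a)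
    u hu le_rfl)

omit [Fintype F] in
theorem planeSpan_le {v w : Vec r F} {S : Set F} {W : Submodule k V}
    (h : ∀ u ∈ planeCompl v w, ∀ a ∈ S, lineWeight ψ ρ u a ≤ W) : planeSpan ψ ρ v w S ≤ W :=
  iSup₂_le fun u hu => iSup₂_le fun a ha => h u hu a ha

omit [Fintype F] in
theorem siegel_sub_mem (hS : SmallRank ψ ρ) {u y : Vec r F} (huy : ω u y = 0)
    {W : Submodule k V} (hW : ∀ a ≠ 0, lineWeight ψ ρ u a ≤ W) (x : V) :
    ρ (siegel u y) x - x ∈ W := by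
  have : W.comap (ρ (siegel u y) - LinearMap.id) = ⊤ := by
    refine hS u y huy _ fun a b d habd x hx => ?_
    have h1 := hx.2.2 1
    rw [one_smul, mul_one] at h1
    simp only [Submodule.mem_comap, LinearMap.sub_apply, LinearMap.id_apply, h1]
    by_cases ha : a = 0
    · have hb : b = 0 := by simpa [ha] using habd.symm
      simp [hb]
    · exact W.sub_mem (W.smul_mem _ (hW a ha hx.1)) (hW a ha hx.1)
  have hx : x ∈ W.comap (ρ (siegel u y) - LinearMap.id) := by rw [this]; trivial
  simpa using hx

/-- The elements acting trivially modulo a subspace. -/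
def trivialModulo (ρ : Sp r F →* (V →ₗ[k] V)) (W : Submodule k V) : Subgroup (Sp r F) where
  carrier := {g | ∀ x, ρ g x - x ∈ W}
  one_mem' x := by simp
  mul_mem' {g h} hg hh x := by
    have := W.add_mem (hg (ρ h x)) (hh x)
    rwa [sub_add_sub_cancel, ← rep_mul_apply] at this
  inv_mem' {g} hg x := by
    have := W.neg_mem (hg (ρ g⁻¹ x))
    rwa [rep_inv_apply, neg_sub] at this

omit [Fintype F] in
theorem planeSpan_ne_zero_eq_top (h2 : (2 : F) ≠ 0) (hr : 2 ≤ r) (hS : SmallRank ψ ρ)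
    (hirr : ∀ U : Submodule k V, (∀ g, ∀ x ∈ U, ρ g x ∈ U) → U = ⊥ ∨ U = ⊤) (hρ : ρ ≠ 1)
    {v w : Vec r F} (hvw : ω v w ≠ 0) : planeSpan ψ ρ v w {a | a ≠ 0} = ⊤ := by
  set Y := planeSpan ψ ρ v w {a | a ≠ 0} with hY
  have hsieg : ∀ u ∈ planeCompl v w, ∀ z, ω u z = 0 → siegel u z ∈ trivialModulo ρ Y :=
    fun u hu z huz x => siegel_sub_mem hS huz (fun a ha => lineWeight_le_planeSpan hu ha) x
  have hgen : transvSubgroup r F ≤ trivialModulo ρ Y := by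
    unfold transvSubgroup
    rw [Subgroup.closure_le]
    rintro _ ⟨z, c, rfl⟩
    obtain ⟨z₁, hz₁, z₂, hz₂, rfl⟩ := exists_planeCompl_add hvw z
    obtain ⟨u, hu, u', hu', huu⟩ := exists_form_ne_zero_planeCompl hr hvw
    rw [transv_add_left (hz₂ z₁ hz₁)]
    refine mul_mem (mul_mem (hsieg _ hz₁ _ (by rw [map_smul, hz₂ _ hz₁, smul_zero])) ?_) ?_
    · have := hsieg z₁ hz₁ ((c / 2) • z₁) (by simp)
      rwa [siegel_self_smul, mul_div_cancel₀ _ h2] at this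
    · have hmem : ∀ y ∈ planeCompl v w, siegel z₂ y ∈ trivialModulo ρ Y := fun y hy => by
        rw [siegel_comm (form_swap_zero (hz₂ y hy))]
        exact hsieg y hy z₂ (hz₂ y hy)
      have hu'' := (planeCompl v w).smul_mem (c / ω u' u) hu'
      have e := siegel_mul_siegel (form_swap_zero (hz₂ u hu)) (form_swap_zero (hz₂ _ hu''))
      have e' : ω ((c / ω u' u) • u') u = c := by
        rw [map_smul, LinearMap.smul_apply, smul_eq_mul, div_mul_cancel₀ _ huu]
      rw [e'] at e
      have : transv z₂ c = (siegel z₂ (u + (c / ω u' u) • u'))⁻¹ *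
          (siegel z₂ u * siegel z₂ ((c / ω u' u) • u')) := by rw [e, inv_mul_cancel_left]
      rw [this]
      exact mul_mem (inv_mem (hmem _ (add_mem hu hu''))) (mul_mem (hmem _ hu) (hmem _ hu''))
  rw [transvSubgroup_eq_top] at hgen
  have hall : ∀ g x, ρ g x - x ∈ Y := fun g => hgen (Subgroup.mem_top g)
  rcases hirr Y fun g x hx => by simpa using Y.add_mem (hall g x) hx with h | h
  · exfalso
    apply hρ
    ext g x
    have := hall g x
    rw [h, Submodule.mem_bot, sub_eq_zero] at this
    simpa using this
  · exact h

theorem lineWeight_sq_le_planeSpan (h2 : (2 : F) ≠ 0) (hr : 2 ≤ r) (hψ : ψ ≠ 1)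
    (hF : (Fintype.card F : k) ≠ 0) (hS : SmallRank ψ ρ)
    (hirr : ∀ U : Submodule k V, (∀ g, ∀ x ∈ U, ρ g x ∈ U) → U = ⊥ ∨ U = ⊤) (hρ : ρ ≠ 1)
    {v w : Vec r F} (hvw : ω v w ≠ 0) (z : Vec r F) {a : F} (ha : a ≠ 0) (hsq : IsSquare a) :
    lineWeight ψ ρ z a ≤ planeSpan ψ ρ v w {a | a ≠ 0 ∧ IsSquare a} := by
  set Y := planeSpan ψ ρ v w {a | a ≠ 0 ∧ IsSquare a} with hY
  have hD : ∀ z, (∀ u ∈ planeCompl v w, ω u z = 0) → lineWeight ψ ρ z a ≤ Y := by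
    intro z hz x hx
    have hle : planeSpan ψ ρ v w {a | a ≠ 0} ≤ Y.comap (lineProj ψ ρ z a) := by
      refine planeSpan_le fun u hu b hb y hy => ?_
      rw [Submodule.mem_comap]
      by_cases hbs : IsSquare b
      · exact lineWeight_le_planeSpan (S := {a | a ≠ 0 ∧ IsSquare a}) hu ⟨hb, hbs⟩
          (lineProj_mem_of_mem (hz u hu) a hy)
      · rw [lineProj_lineProj_eq_zero hψ hF hS (hz u hu) (fun h => hbs ?_) hy]
        · exact zero_mem _
        · have := h.div hsq
          rwa [mul_div_cancel_right₀ _ ha] at this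
    have : x ∈ planeSpan ψ ρ v w {a | a ≠ 0} := by
      rw [planeSpan_ne_zero_eq_top h2 hr hS hirr hρ hvw]; trivial
    have := hle this
    rwa [Submodule.mem_comap, lineProj_of_mem hF hx] at this
  obtain ⟨z₁, hz₁, z₂, hz₂, rfl⟩ := exists_planeCompl_add hvw z
  have htop : Y.comap (lineProj ψ ρ (z₁ + z₂) a) = ⊤ := by
    refine hS z₁ z₂ (hz₂ z₁ hz₁) _ fun α β δ h x hx => ?_
    have hx' := mem_lineWeight_add_smul (hz₂ z₁ hz₁) hx 1
    rw [one_smul] at hx'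
    rw [Submodule.mem_comap]
    by_cases hw : a = α + 2 * β * 1 + δ * 1 ^ 2
    · rw [← hw] at hx'
      rw [lineProj_of_mem hF hx']
      by_cases hα : α = 0
      · have hβ : β = 0 := by simpa [hα] using h.symm
        have hδ : δ = a := by rw [hw, hα, hβ]; ring
        exact hD z₂ hz₂ (hδ ▸ hx.2.1)
      · refine lineWeight_le_planeSpan (S := {a | a ≠ 0 ∧ IsSquare a}) hz₁ ⟨hα, ?_⟩ hx.1
        have : IsSquare (α * a) := ⟨α + β, by rw [hw]; linear_combination h⟩
        have := this.div hsq
        rwa [mul_div_cancel_right₀ _ ha] at this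
    · rw [lineProj_of_mem_of_ne hψ hx' hw]
      exact zero_mem _
  intro x hx
  have : x ∈ Y.comap (lineProj ψ ρ (z₁ + z₂) a) := by rw [htop]; trivial
  rwa [Submodule.mem_comap, lineProj_of_mem hF hx] at this

theorem planeSpan_sq_eq_top (h2 : (2 : F) ≠ 0) (hr : 2 ≤ r) (hψ : ψ ≠ 1)
    (hF : (Fintype.card F : k) ≠ 0) (hS : SmallRank ψ ρ)
    (hirr : ∀ U : Submodule k V, (∀ g, ∀ x ∈ U, ρ g x ∈ U) → U = ⊥ ∨ U = ⊤) (hρ : ρ ≠ 1)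
    (hone : ∃ u, lineWeight ψ ρ u 1 ≠ ⊥) {v w : Vec r F} (hvw : ω v w ≠ 0) :
    planeSpan ψ ρ v w {a | a ≠ 0 ∧ IsSquare a} = ⊤ := by
  let Z : Submodule k V := ⨆ u, ⨆ a ∈ {a : F | a ≠ 0 ∧ IsSquare a}, lineWeight ψ ρ u a
  have hZ : ∀ u, ∀ a ∈ {a : F | a ≠ 0 ∧ IsSquare a}, lineWeight ψ ρ u a ≤ Z := fun u a ha =>
    le_trans (le_iSup₂_of_le a ha le_rfl)
      (le_iSup (fun u => ⨆ a ∈ {a : F | a ≠ 0 ∧ IsSquare a}, lineWeight ψ ρ u a) u)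
  have hinv : ∀ g, ∀ x ∈ Z, ρ g x ∈ Z := by
    intro g x hx
    have : Z ≤ Z.comap (ρ g) := iSup_le fun u => iSup₂_le fun a ha y hy =>
      hZ _ a ha (rep_mem_lineWeight g hy)
    exact this hx
  rcases hirr Z hinv with h | h
  · obtain ⟨u, hu⟩ := hone
    exact absurd (le_bot_iff.mp (h ▸ hZ u 1 ⟨one_ne_zero, IsSquare.one⟩)) hu
  · rw [eq_top_iff, ← h]
    exact iSup_le fun u => iSup₂_le fun a ha =>
      lineWeight_sq_le_planeSpan h2 hr hψ hF hS hirr hρ hvw u ha.1 ha.2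

end Spanning

section Theta

variable {F k : Type*} [Field F] [Field k] {ψ : AddChar F k}

open Classical in
/-- The value `ψ s + ψ (-s)` at a square `s ^ 2`, extended by zero. -/
noncomputable def thetaValue (ψ : AddChar F k) (a : F) : k :=
  if h : IsSquare a then ψ h.choose + ψ (-h.choose) else 0

theorem thetaValue_sq (s : F) : thetaValue ψ (s ^ 2) = ψ s + ψ (-s) := by
  have h : IsSquare (s ^ 2) := IsSquare.sq s
  rw [thetaValue, dif_pos h]
  have := h.choose_spec
  rw [← pow_two] at this
  generalize h.choose = t at this ⊢
  rcases sq_eq_sq_iff_eq_or_eq_neg.mp this with rfl | rfl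
  · rfl
  · rw [neg_neg, add_comm]

end Theta

section Operators

variable {r : ℕ} {F k V : Type*} [Field F] [Fintype F] [Field k] [AddCommGroup V] [Module k V]
  {ψ : AddChar F k} {ρ : Sp r F →* (V →ₗ[k] V)}

/-- The operator acting on `lineWeight ψ ρ v (s ^ 2)` through `ψ s + ψ (-s)`. -/
noncomputable def weil (ψ : AddChar F k) (ρ : Sp r F →* (V →ₗ[k] V)) (v : Vec r F) : V →ₗ[k] V :=
  ∑ a, thetaValue ψ a • lineProj ψ ρ v a

theorem weil_of_mem (hψ : ψ ≠ 1) (hF : (Fintype.card F : k) ≠ 0) {v : Vec r F} {a : F} {x : V}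
    (hx : x ∈ lineWeight ψ ρ v a) : weil ψ ρ v x = thetaValue ψ a • x := by
  rw [weil, LinearMap.sum_apply, Finset.sum_eq_single a]
  · rw [LinearMap.smul_apply, lineProj_of_mem hF hx]
  · intro b _ hb
    rw [LinearMap.smul_apply, lineProj_of_mem_of_ne hψ hx hb, smul_zero]
  · simp

theorem weil_neg (v : Vec r F) : weil ψ ρ (-v) = weil ψ ρ v := by
  have : ∀ c, transv (-v) c = transv v c := fun c => by
    have := transv_smul (-1) v c
    simpa using this
  simp only [weil, lineProj, this]

theorem weil_zero (hψ : ψ ≠ 1) (hF : (Fintype.card F : k) ≠ 0) (x : V) :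
    weil ψ ρ (0 : Vec r F) x = (2 : k) • x := by
  have hx : x ∈ lineWeight ψ ρ (0 : Vec r F) 0 := fun c => by simp [transv_zero_left]
  rw [weil_of_mem hψ hF hx]
  have := thetaValue_sq (ψ := ψ) 0
  rw [zero_pow two_ne_zero] at this
  rw [this, neg_zero, AddChar.map_zero_eq_one, one_add_one_eq_two]

theorem weil_of_perp (h2 : (2 : F) ≠ 0) (hψ : ψ ≠ 1) (hF : (Fintype.card F : k) ≠ 0)
    (hS : SmallRank ψ ρ) {u v : Vec r F} (huv : ω u v = 0) {s : F} (hs : s ≠ 0) {x : V}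
    (hx : x ∈ lineWeight ψ ρ u (s ^ 2)) :
    weil ψ ρ v x = ρ (siegel u ((1 / (2 * s)) • v)) x + ρ (siegel u (-(1 / (2 * s)) • v)) x := by
  have key : LinearMap.ker ((weil ψ ρ v - (ρ (siegel u ((1 / (2 * s)) • v)) +
      ρ (siegel u (-(1 / (2 * s)) • v)))) ∘ₗ lineProj ψ ρ u (s ^ 2)) = ⊤ := by
    refine hS u v huv _ fun α β δ h y hy => ?_
    rw [LinearMap.mem_ker, LinearMap.comp_apply]
    by_cases h1 : s ^ 2 = α
    · subst h1
      have hδ : δ = (β / s) ^ 2 := by field_simp; rw [← h]; ring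
      rw [lineProj_of_mem hF hy.1, LinearMap.sub_apply, LinearMap.add_apply,
        weil_of_mem hψ hF hy.2.1, hy.2.2, hy.2.2, hδ, thetaValue_sq, add_smul, sub_eq_zero]
      congr 3 <;> field_simp
    · rw [lineProj_of_mem_of_ne hψ hy.1 h1, map_zero]
  have := LinearMap.congr_fun (LinearMap.ker_eq_top.mp key) x
  rw [LinearMap.comp_apply, lineProj_of_mem hF hx] at this
  rwa [LinearMap.sub_apply, LinearMap.add_apply, LinearMap.zero_apply, sub_eq_zero] at this

/-- The rank-one property together with the absence of non-square weights. -/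
structure SquareType (ψ : AddChar F k) (ρ : Sp r F →* (V →ₗ[k] V)) : Prop where
  smallRank : SmallRank ψ ρ
  span : ∀ v w : Vec r F, ω v w ≠ 0 → planeSpan ψ ρ v w {a | a ≠ 0 ∧ IsSquare a} = ⊤

theorem SquareType.lineWeight_eq_bot (hρ : SquareType ψ ρ) (hψ : ψ ≠ 1)
    (hF : (Fintype.card F : k) ≠ 0) (v : Vec r F) {a : F} (ha : ¬ IsSquare a) :
    lineWeight ψ ρ v a = ⊥ := by
  rw [Submodule.eq_bot_iff]
  intro x hx
  by_cases hv : v = 0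
  · subst hv
    have h0 : x ∈ lineWeight ψ ρ (0 : Vec r F) 0 := fun c => by simp [transv_zero_left]
    rw [← lineProj_of_mem hF hx]
    refine lineProj_of_mem_of_ne hψ h0 ?_
    rintro rfl
    exact ha IsSquare.zero
  · obtain ⟨w, hw⟩ := form_nondegenerate hv
    have hle : planeSpan ψ ρ v w {a | a ≠ 0 ∧ IsSquare a} ≤ LinearMap.ker (lineProj ψ ρ v a) := by
      refine planeSpan_le fun u hu b hb y hy => ?_
      rw [LinearMap.mem_ker]
      refine lineProj_lineProj_eq_zero hψ hF hρ.smallRank hu.1 (fun h => ha ?_) hy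
      have := h.div hb.2
      rwa [mul_div_cancel_left₀ _ hb.1] at this
    rw [hρ.span v w hw] at hle
    have : x ∈ LinearMap.ker (lineProj ψ ρ v a) := hle trivial
    rwa [LinearMap.mem_ker, lineProj_of_mem hF hx] at this

theorem weil_mul_of_ne (h2 : (2 : F) ≠ 0) (hψ : ψ ≠ 1) (hF : (Fintype.card F : k) ≠ 0)
    (hρ : SquareType ψ ρ) {v w : Vec r F} (hvw : ω v w ≠ 0) (x : V) :
    weil ψ ρ v (weil ψ ρ w x) =
      ψ (ω w v / 4) • weil ψ ρ (v + w) x + ψ (-(ω w v / 4)) • weil ψ ρ (v - w) x := by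
  have h4 : (4 : F) ≠ 0 := by
    rw [show (4 : F) = 2 * 2 by norm_num]; exact mul_ne_zero h2 h2
  suffices h : LinearMap.ker (weil ψ ρ v ∘ₗ weil ψ ρ w - (ψ (ω w v / 4) • weil ψ ρ (v + w) +
      ψ (-(ω w v / 4)) • weil ψ ρ (v - w))) = ⊤ by
    have := LinearMap.congr_fun (LinearMap.ker_eq_top.mp h) x
    simpa [sub_eq_zero] using this
  rw [eq_top_iff, ← hρ.span v w hvw]
  refine planeSpan_le fun u hu a ha x hx => ?_
  obtain ⟨ha0, s, rfl⟩ := ha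
  have hs : s ≠ 0 := fun h => ha0 (by simp [h])
  rw [← pow_two] at hx
  obtain ⟨huv, huw⟩ := hu
  have hperp : ∀ y z : Vec r F, ω u y = 0 → ω u z = 0 → ω u (y + z) = 0 := fun y z hy hz => by
    rw [map_add, hy, hz, add_zero]
  have hsm : ∀ (c : F) (y : Vec r F), ω u y = 0 → ω u (c • y) = 0 := fun c y hy => by
    rw [map_smul, hy, smul_zero]
  set p := 1 / (2 * s) with hp
  have hmem : ∀ y : Vec r F, ω u y = 0 → ρ (siegel u y) x ∈ lineWeight ψ ρ u (s ^ 2) := by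
    intro y hy
    refine rep_mem_lineWeight_of_commute (fun c => ?_) hx
    unfold siegel
    refine Commute.mul_left (Commute.mul_left ?_ ?_) ?_ <;>
      exact transv_commute (by simp [form_swap_zero hy]) _ _
  have hW := fun (y : Vec r F) (hy : ω u y = 0) (x : V) (hx : x ∈ lineWeight ψ ρ u (s ^ 2)) =>
    weil_of_perp h2 hψ hF hρ.smallRank hy hs hx
  rw [← hp] at hW
  have hprod : ∀ c d : F, ρ (siegel u (c • v)) (ρ (siegel u (d • w)) x) =
      ψ (s ^ 2 * (c * d) * ω w v) • ρ (siegel u (c • v + d • w)) x := by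
    intro c d
    rw [← rep_mul_apply, siegel_mul_siegel (hsm _ _ huv) (hsm _ _ huw), rep_mul_apply, hx, map_smul]
    congr 2
    simp only [map_smul, LinearMap.smul_apply, smul_eq_mul]
    ring
  rw [LinearMap.mem_ker, LinearMap.sub_apply, sub_eq_zero, LinearMap.comp_apply,
    LinearMap.add_apply, LinearMap.smul_apply, LinearMap.smul_apply,
    hW w huw x hx, map_add, hW v huv _ (hmem _ (hsm _ _ huw)), hW v huv _ (hmem _ (hsm _ _ huw)),
    hW (v + w) (hperp _ _ huv huw) x hx, hW (v - w) (by rw [map_sub, huv, huw, sub_zero]) x hx,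
    hprod, hprod, hprod, hprod]
  have e1 : s ^ 2 * (p * p) * ω w v = ω w v / 4 := by
    rw [hp]; field_simp; norm_num; ring
  have e2 : s ^ 2 * (-p * p) * ω w v = -(ω w v / 4) := by rw [← e1]; ring
  have e3 : s ^ 2 * (p * -p) * ω w v = -(ω w v / 4) := by rw [← e1]; ring
  have e4 : s ^ 2 * (-p * -p) * ω w v = ω w v / 4 := by rw [← e1]; ring
  rw [e1, e2, e3, e4, show p • v + p • w = p • (v + w) by module,
    show -p • v + -p • w = -p • (v + w) by module, show p • v + -p • w = p • (v - w) by module,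
    show -p • v + p • w = -p • (v - w) by module,
    smul_add (ψ (ω w v / 4)), smul_add (ψ (-(ω w v / 4)))]
  abel

theorem weil_mul_of_eq (hψ : ψ ≠ 1) (hF : (Fintype.card F : k) ≠ 0)
    (hρ : SquareType ψ ρ) {v w : Vec r F} (hvw : ω v w = 0) (x : V) :
    weil ψ ρ v (weil ψ ρ w x) = weil ψ ρ (v + w) x + weil ψ ρ (v - w) x := by
  suffices h : LinearMap.ker (weil ψ ρ v ∘ₗ weil ψ ρ w - (weil ψ ρ (v + w) +
      weil ψ ρ (v - w))) = ⊤ by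
    have := LinearMap.congr_fun (LinearMap.ker_eq_top.mp h) x
    simpa [sub_eq_zero] using this
  refine hρ.smallRank v w hvw _ fun α β δ h x hx => ?_
  by_cases hα : IsSquare α
  swap
  · have := hx.1
    rw [hρ.lineWeight_eq_bot hψ hF v hα, Submodule.mem_bot] at this
    rw [this]; exact zero_mem _
  by_cases hδ : IsSquare δ
  swap
  · have := hx.2.1
    rw [hρ.lineWeight_eq_bot hψ hF w hδ, Submodule.mem_bot] at this
    rw [this]; exact zero_mem _
  obtain ⟨s, rfl⟩ := hα
  obtain ⟨t, ht, hβ⟩ : ∃ t, δ = t ^ 2 ∧ β = s * t := by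
    obtain ⟨t, rfl⟩ := hδ
    have : (s * t) ^ 2 = β ^ 2 := by rw [← h]; ring
    rcases sq_eq_sq_iff_eq_or_eq_neg.mp this with e | e
    · exact ⟨t, by ring, e.symm⟩
    · exact ⟨-t, by ring, by rw [mul_neg, e, neg_neg]⟩
  subst ht hβ
  have hp := mem_lineWeight_add_smul hvw hx 1
  have hm := mem_lineWeight_add_smul hvw hx (-1)
  rw [one_smul] at hp
  rw [neg_one_smul, ← sub_eq_add_neg] at hm
  rw [LinearMap.mem_ker, LinearMap.sub_apply, sub_eq_zero, LinearMap.comp_apply,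
    LinearMap.add_apply, weil_of_mem hψ hF hx.2.1, map_smul, weil_of_mem hψ hF hx.1,
    weil_of_mem hψ hF hp, weil_of_mem hψ hF hm, ← pow_two,
    show s ^ 2 + 2 * (s * t) * 1 + t ^ 2 * 1 ^ 2 = (s + t) ^ 2 by ring,
    show s ^ 2 + 2 * (s * t) * (-1) + t ^ 2 * (-1) ^ 2 = (s - t) ^ 2 by ring, thetaValue_sq,
    thetaValue_sq, thetaValue_sq, thetaValue_sq, smul_smul, ← add_smul]
  congr 1
  rw [show -(s + t) = -s + -t by ring, show -(s - t) = -s + t by ring, sub_eq_add_neg]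
  simp only [AddChar.map_add_eq_mul]
  ring

/-- The multiplication rule of the operators `weil ψ ρ v`. -/
theorem weil_mul (h2 : (2 : F) ≠ 0) (hψ : ψ ≠ 1) (hF : (Fintype.card F : k) ≠ 0)
    (hρ : SquareType ψ ρ) (v w : Vec r F) (x : V) :
    weil ψ ρ v (weil ψ ρ w x) =
      ψ (ω w v / 4) • weil ψ ρ (v + w) x + ψ (-(ω w v / 4)) • weil ψ ρ (v - w) x := by
  by_cases h : ω v w = 0
  · rw [weil_mul_of_eq hψ hF hρ h, form_swap_zero h]
    simp
  · exact weil_mul_of_ne h2 hψ hF hρ h x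

end Operators

section Recover

variable {r : ℕ} {F k V : Type*} [Field F] [Fintype F] [Field k] [AddCommGroup V] [Module k V]
  {ψ : AddChar F k} {ρ : Sp r F →* (V →ₗ[k] V)}

theorem sum_weil_smul (hψ : ψ ≠ 1) (hF : (Fintype.card F : k) ≠ 0)
    (hsq : ∀ (v : Vec r F) (a : F), ¬ IsSquare a → lineWeight ψ ρ v a = ⊥) (v : Vec r F) {s : F}
    (hs : s ≠ 0) (h2 : (2 : F) ≠ 0) (x : V) :
    ∑ c, ψ (-(c * s)) • weil ψ ρ (c • v) x = (Fintype.card F : k) • lineProj ψ ρ v (s ^ 2) x := by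
  classical
  suffices h : LinearMap.ker (∑ c, ψ (-(c * s)) • weil ψ ρ (c • v) -
      (Fintype.card F : k) • lineProj ψ ρ v (s ^ 2)) = ⊤ by
    have := LinearMap.congr_fun (LinearMap.ker_eq_top.mp h) x
    simpa [sub_eq_zero, LinearMap.sum_apply] using this
  refine eq_top_of_lineWeight_le (ρ := ρ) hψ hF v fun a y hy => ?_
  by_cases ha : IsSquare a
  swap
  · rw [hsq v a ha, Submodule.mem_bot] at hy
    rw [hy]; exact zero_mem _
  obtain ⟨t, rfl⟩ := ha
  rw [← pow_two] at hy
  have hw : ∀ c : F, weil ψ ρ (c • v) y = (ψ (c * t) + ψ (-(c * t))) • y := by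
    intro c
    rw [← thetaValue_sq]
    refine weil_of_mem hψ hF fun d => ?_
    rw [transv_smul, hy]
    congr 2
    ring
  have hsum : ∀ b : F, ∑ c, ψ (c * b) = if b = 0 then (Fintype.card F : k) else 0 := by
    intro b
    have hp := (AddChar.IsPrimitive.of_ne_one hψ)
    have := AddChar.sum_mulShift b hp
    simpa using this
  have e : ∑ c, ψ (-(c * s)) * (ψ (c * t) + ψ (-(c * t))) =
      (if t - s = 0 then (Fintype.card F : k) else 0) +
      (if -(t + s) = 0 then (Fintype.card F : k) else 0) := by
    rw [← hsum, ← hsum, ← Finset.sum_add_distrib]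
    refine Finset.sum_congr rfl fun c _ => ?_
    rw [mul_add, ← AddChar.map_add_eq_mul, ← AddChar.map_add_eq_mul]
    congr 2 <;> ring
  rw [LinearMap.mem_ker, LinearMap.sub_apply, sub_eq_zero, LinearMap.sum_apply,
    LinearMap.smul_apply]
  simp only [LinearMap.smul_apply, hw, smul_smul]
  rw [← Finset.sum_smul, e]
  by_cases h1 : t = s
  · subst h1
    rw [lineProj_of_mem hF hy, if_pos (sub_self t), if_neg, add_zero]
    rw [← two_mul, neg_eq_zero]
    exact mul_ne_zero h2 hs
  · by_cases h3 : t = -s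
    · subst h3
      rw [neg_sq] at hy
      rw [lineProj_of_mem hF hy, if_neg (sub_ne_zero.mpr h1), if_pos (by ring), zero_add]
    · rw [lineProj_of_mem_of_ne hψ hy, if_neg (sub_ne_zero.mpr h1), if_neg]
      · simp
      · rw [neg_eq_zero, add_eq_zero_iff_eq_neg]; exact h3
      · intro h
        rcases sq_eq_sq_iff_eq_or_eq_neg.mp h with e | e
        · exact h1 e.symm
        · exact h3 (by rw [e, neg_neg])

/-- Subspaces invariant under the operators `weil` are subrepresentations. -/
theorem rep_mem_of_weil_mem (h2 : (2 : F) ≠ 0) (hψ : ψ ≠ 1) (hF : (Fintype.card F : k) ≠ 0)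
    (hsq : ∀ (v : Vec r F) (a : F), ¬ IsSquare a → lineWeight ψ ρ v a = ⊥) {U : Submodule k V}
    (hU : ∀ v, ∀ x ∈ U, weil ψ ρ v x ∈ U) (g : Sp r F) : ∀ x ∈ U, ρ g x ∈ U := by
  have hproj : ∀ (v : Vec r F) (a : F), a ≠ 0 → ∀ x ∈ U, lineProj ψ ρ v a x ∈ U := by
    intro v a ha x hx
    by_cases has : IsSquare a
    · obtain ⟨s, rfl⟩ := has
      have hs : s ≠ 0 := fun h => ha (by simp [h])
      have e := sum_weil_smul hψ hF hsq v hs h2 x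
      rw [← pow_two, ← inv_smul_smul₀ hF (lineProj ψ ρ v (s ^ 2) x), ← e]
      exact U.smul_mem _ (U.sum_mem fun c _ => U.smul_mem _ (hU _ _ hx))
    · have := lineProj_mem (ψ := ψ) (ρ := ρ) v a x
      rw [hsq v a has, Submodule.mem_bot] at this
      rw [this]; exact U.zero_mem
  have hT : ∀ (v : Vec r F) (c : F) (x : V), ρ (transv v c) x =
      x + ∑ a, (ψ (a * c) - 1) • lineProj ψ ρ v a x := by
    intro v c x
    suffices h : LinearMap.ker (ρ (transv v c) - (LinearMap.id +
        ∑ a, (ψ (a * c) - 1) • lineProj ψ ρ v a)) = ⊤ by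
      have := LinearMap.congr_fun (LinearMap.ker_eq_top.mp h) x
      simpa [sub_eq_zero, LinearMap.sum_apply] using this
    refine eq_top_of_lineWeight_le (ρ := ρ) hψ hF v fun a y hy => ?_
    rw [LinearMap.mem_ker, LinearMap.sub_apply, LinearMap.add_apply, LinearMap.sum_apply,
      Finset.sum_eq_single a, hy c, LinearMap.smul_apply, lineProj_of_mem hF hy, sub_smul]
    · simp
    · intro b _ hb
      rw [LinearMap.smul_apply, lineProj_of_mem_of_ne hψ hy hb, smul_zero]
    · simp
  have hgen : transvSubgroup r F ≤
      { carrier := {g | ∀ x, x ∈ U ↔ ρ g x ∈ U}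
        one_mem' := fun x => by simp
        mul_mem' := fun {g h} hg hh x => by rw [rep_mul_apply, ← hg, ← hh]
        inv_mem' := fun {g} hg x => by rw [hg (ρ g⁻¹ x), rep_inv_apply] : Subgroup (Sp r F) } := by
    unfold transvSubgroup
    rw [Subgroup.closure_le]
    rintro _ ⟨v, c, rfl⟩ x
    have h1 : ∀ c, ∀ x ∈ U, ρ (transv v c) x ∈ U := by
      intro c x hx
      rw [hT]
      refine U.add_mem hx (U.sum_mem fun a _ => ?_)
      by_cases ha : a = 0
      · simp [ha]
      · exact U.smul_mem _ (hproj v a ha x hx)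
    refine ⟨h1 c x, fun h => ?_⟩
    have := h1 (-c) _ h
    rwa [← rep_mul_apply, ← transv_add_right, neg_add_cancel, transv_zero_right, map_one] at this
  rw [transvSubgroup_eq_top] at hgen
  exact fun x hx => (hgen (Subgroup.mem_top g) x).mp hx

end Recover

section System

variable {r : ℕ} {F k V : Type*} [Field F] [Field k] [AddCommGroup V] [Module k V]

/-- A family of operators indexed by a symplectic space that multiply like the symmetrised
operators `W v + W (-v)` of a Weil representation. -/
structure WeilSystem (φ : AddChar F k) (A : Vec r F → Module.End k V) : Prop where
  zero : A 0 = (2 : k) • 1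
  neg : ∀ v, A (-v) = A v
  mul : ∀ v w, A v * A w = φ (ω w v) • A (v + w) + φ (-(ω w v)) • A (v - w)

theorem sum_addChar_dotProduct [Fintype F] [DecidableEq F] {φ : AddChar F k} (hφ : φ ≠ 1) (b : Fin r → F) :
    ∑ s : Fin r → F, φ (s ⬝ᵥ b) = if b = 0 then (Fintype.card (Fin r → F) : k) else 0 := by
  classical
  let χ : AddChar (Fin r → F) k :=
    { toFun := fun s => φ (s ⬝ᵥ b)
      map_zero_eq_one' := by simp
      map_add_eq_mul' := fun s t => by rw [add_dotProduct, AddChar.map_add_eq_mul] }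
  have hχ : χ = 0 ↔ b = 0 := by
    constructor
    · intro h
      by_contra hb
      obtain ⟨i, hi⟩ := Function.ne_iff.mp hb
      apply hφ
      ext c
      have := DFunLike.congr_fun h (Pi.single i (c / b i))
      have e : φ ((Pi.single i (c / b i) : Fin r → F) ⬝ᵥ b) = 1 := this
      rw [single_dotProduct, div_mul_cancel₀ _ hi] at e
      rw [e, AddChar.one_apply]
    · rintro rfl
      ext s
      show φ (s ⬝ᵥ 0) = _
      simp
  have := AddChar.sum_eq_ite χ
  rw [if_congr hχ rfl rfl] at this
  exact this

/-- The operators `E a b + E (-a) (-b)` in terms of matrix units `E`. -/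
noncomputable def unit [Fintype F] (φ : AddChar F k) (A : Vec r F → Module.End k V)
    (a b : Fin r → F) : Module.End k V :=
  (Fintype.card (Fin r → F) : k)⁻¹ • ∑ s : Fin r → F, φ (-(s ⬝ᵥ (a + b))) • A (Sum.elim s (a - b))

variable {φ : AddChar F k} {A : Vec r F → Module.End k V}

theorem WeilSystem.unit_neg [Fintype F] (hA : WeilSystem φ A) (a b : Fin r → F) :
    unit φ A (-a) (-b) = unit φ A a b := by
  unfold unit
  congr 1
  refine Fintype.sum_equiv (Equiv.neg _) _ _ fun s => ?_
  rw [← hA.neg, Equiv.neg_apply, neg_dotProduct, ← Sum.elim_neg_neg]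
  congr 2
  · congr 2
    simp only [dotProduct_add, dotProduct_neg]
    ring
  · congr 2
    abel

theorem unit_mul_aux [Fintype F] [DecidableEq F] (hφ : φ ≠ 1) (h2 : (2 : F) ≠ 0)
    (hX : (Fintype.card (Fin r → F) : k) ≠ 0) (a b c d : Fin r → F) :
    ∑ s : Fin r → F, ∑ t : Fin r → F,
      φ (-(s ⬝ᵥ (a + b)) - t ⬝ᵥ (c + d) + (s ⬝ᵥ (c - d) - t ⬝ᵥ (a - b))) •
        A (Sum.elim (s + t) (a - b + (c - d))) =
      if b = c then (Fintype.card (Fin r → F) : k) • (Fintype.card (Fin r → F) : k) • unit φ A a d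
      else 0 := by
  have e1 : ∀ t : Fin r → F, ∑ s : Fin r → F,
      φ (-(s ⬝ᵥ (a + b)) - t ⬝ᵥ (c + d) + (s ⬝ᵥ (c - d) - t ⬝ᵥ (a - b))) •
        A (Sum.elim (s + t) (a - b + (c - d))) =
      ∑ s : Fin r → F, (φ (t ⬝ᵥ ((2 : F) • (b - c))) * φ (s ⬝ᵥ (-(a + b) + (c - d)))) •
        A (Sum.elim s (a - b + (c - d))) := by
    intro t
    refine Fintype.sum_equiv (Equiv.addRight t) _ _ fun s => ?_
    rw [Equiv.coe_addRight, ← AddChar.map_add_eq_mul]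
    congr 2
    simp only [dotProduct_add, dotProduct_sub, dotProduct_neg, add_dotProduct, dotProduct_smul,
      smul_eq_mul]
    ring
  rw [Finset.sum_comm, Finset.sum_congr rfl fun t _ => e1 t, Finset.sum_comm]
  simp only [← Finset.sum_smul, ← Finset.sum_mul]
  rw [sum_addChar_dotProduct hφ]
  by_cases h : b = c
  · subst h
    rw [if_pos (by simp), if_pos rfl]
    unfold unit
    rw [smul_inv_smul₀ hX, Finset.smul_sum]
    refine Finset.sum_congr rfl fun s _ => ?_
    rw [smul_smul, ← dotProduct_neg]
    congr 4 <;> abel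
  · rw [if_neg, if_neg h]
    · simp
    · rw [smul_eq_zero]
      rintro (h' | h')
      · exact h2 h'
      · exact h (sub_eq_zero.mp h')

theorem WeilSystem.unit_mul [Fintype F] [DecidableEq F] (hA : WeilSystem φ A) (hφ : φ ≠ 1)
    (h2 : (2 : F) ≠ 0) (hX : (Fintype.card (Fin r → F) : k) ≠ 0) (a b c d : Fin r → F) :
    unit φ A a b * unit φ A c d =
      (if b = c then unit φ A a d else 0) + (if b = -c then unit φ A a (-d) else 0) := by
  have e1 := unit_mul_aux (A := A) hφ h2 hX a b c d
  have e2 := unit_mul_aux (A := A) hφ h2 hX a b (-c) (-d)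
  have e3 : unit φ A a b * unit φ A c d = (Fintype.card (Fin r → F) : k)⁻¹ •
      (Fintype.card (Fin r → F) : k)⁻¹ • ((∑ s : Fin r → F, ∑ t : Fin r → F,
      φ (-(s ⬝ᵥ (a + b)) - t ⬝ᵥ (c + d) + (s ⬝ᵥ (c - d) - t ⬝ᵥ (a - b))) •
        A (Sum.elim (s + t) (a - b + (c - d)))) + ∑ s : Fin r → F, ∑ t : Fin r → F,
      φ (-(s ⬝ᵥ (a + b)) - t ⬝ᵥ (-c + -d) + (s ⬝ᵥ (-c - -d) - t ⬝ᵥ (a - b))) •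
        A (Sum.elim (s + t) (a - b + (-c - -d)))) := by
    conv_lhs => rw [unit, unit, smul_mul_smul_comm, ← smul_smul, Finset.sum_mul_sum]
    congr 2
    rw [← Finset.sum_add_distrib]
    refine Finset.sum_congr rfl fun s _ => ?_
    have e4 : ∑ t : Fin r → F,
      φ (-(s ⬝ᵥ (a + b)) - t ⬝ᵥ (-c + -d) + (s ⬝ᵥ (-c - -d) - t ⬝ᵥ (a - b))) •
        A (Sum.elim (s + t) (a - b + (-c - -d))) = ∑ t : Fin r → F,
      φ (-(s ⬝ᵥ (a + b)) - -t ⬝ᵥ (-c + -d) + (s ⬝ᵥ (-c - -d) - -t ⬝ᵥ (a - b))) •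
        A (Sum.elim (s + -t) (a - b + (-c - -d))) :=
      Fintype.sum_equiv (Equiv.neg _) _ _ fun t => by simp
    rw [e4, ← Finset.sum_add_distrib]
    refine Finset.sum_congr rfl fun t _ => ?_
    rw [smul_mul_smul_comm, hA.mul, smul_add, smul_smul, smul_smul, ← AddChar.map_add_eq_mul,
      ← AddChar.map_add_eq_mul, ← AddChar.map_add_eq_mul, form_sumElim, dotProduct_comm _ s]
    congr 3
    · ring
    · rw [← Sum.elim_add_add]
    · simp only [dotProduct_add, dotProduct_sub, dotProduct_neg, neg_dotProduct]
      ring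
    · rw [sub_eq_add_neg, ← Sum.elim_neg_neg, ← Sum.elim_add_add]
      congr 2
      abel
  rw [e3, e1, e2, smul_add, smul_add]
  congr 1
  · split_ifs
    · rw [inv_smul_smul₀ hX, inv_smul_smul₀ hX]
    · simp
  · split_ifs
    · rw [inv_smul_smul₀ hX, inv_smul_smul₀ hX]
    · simp

theorem sum_unit [Fintype F] [DecidableEq F] (hφ : φ ≠ 1) (h2 : (2 : F) ≠ 0)
    (hX : (Fintype.card (Fin r → F) : k) ≠ 0) (s t : Fin r → F) :
    A (Sum.elim s t) = ∑ b : Fin r → F, φ (s ⬝ᵥ ((2 : F) • b + t)) • unit φ A (b + t) b := by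
  have e : ∀ b : Fin r → F, φ (s ⬝ᵥ ((2 : F) • b + t)) • unit φ A (b + t) b =
      (Fintype.card (Fin r → F) : k)⁻¹ • ∑ u : Fin r → F,
        (φ (b ⬝ᵥ ((2 : F) • (s - u))) * φ ((s - u) ⬝ᵥ t)) • A (Sum.elim u t) := by
    intro b
    rw [unit, smul_comm, Finset.smul_sum]
    congr 1
    refine Finset.sum_congr rfl fun u _ => ?_
    rw [smul_smul, ← AddChar.map_add_eq_mul, ← AddChar.map_add_eq_mul, add_sub_cancel_left]
    congr 2
    simp only [dotProduct_add, sub_dotProduct, dotProduct_smul, smul_eq_mul,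
      dotProduct_comm b, smul_dotProduct]
    ring
  rw [Finset.sum_congr rfl fun b _ => e b, ← Finset.smul_sum, Finset.sum_comm]
  simp only [← Finset.sum_smul, ← Finset.sum_mul, sum_addChar_dotProduct hφ]
  rw [Finset.sum_eq_single s]
  · simp only [sub_self, smul_zero, if_true, zero_dotProduct, AddChar.map_zero_eq_one, mul_one]
    rw [inv_smul_smul₀ hX]
  · intro u _ hu
    rw [if_neg, zero_mul, zero_smul]
    rw [smul_eq_zero]
    rintro (h' | h')
    · exact h2 h'
    · exact hu (sub_eq_zero.mp h').symm
  · simp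

end System

section Frame

variable {r : ℕ} {F k V : Type*} [Field F] [Fintype F] [DecidableEq F] [Field k] [AddCommGroup V]
  [Module k V] {φ : AddChar F k} {A : Vec r F → Module.End k V}

/-- Vectors on which the operators `unit φ A a b` act like symmetrised matrix units. -/
structure WeilFrame (φ : AddChar F k) (A : Vec r F → Module.End k V) (ξ : Fin r → F)
    (w : (Fin r → F) → V) (ε : k) : Prop where
  eps : ε = 1 ∨ ε = -1
  neg : ∀ a, w (-a) = ε • w a
  unit_apply : ∀ c d a, unit φ A c d (w a) =
    (if d = a then w c else 0) + (if d = -a then ε • w c else 0)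
  span : Submodule.span k (Set.range w) = ⊤
  ne_zero : w ξ ≠ 0
  zero_iff : w 0 = 0 ↔ ε = -1

theorem mem_of_unit_mem (hφ : φ ≠ 1) (h2 : (2 : F) ≠ 0)
    (hX : (Fintype.card (Fin r → F) : k) ≠ 0) {U : Submodule k V} {x : V}
    (h : ∀ c d, unit φ A c d x ∈ U) (v : Vec r F) : A v x ∈ U := by
  rw [← Sum.elim_comp_inl_inr v, sum_unit (A := A) hφ h2 hX, LinearMap.sum_apply]
  exact U.sum_mem fun b _ => U.smul_mem _ (h _ _)

omit [Fintype F] [DecidableEq F] in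
theorem ne_neg_self (h2 : (2 : F) ≠ 0) {a : Fin r → F} (ha : a ≠ 0) : a ≠ -a := by
  intro h
  have : (2 : F) • a = 0 := by rw [two_smul]; nth_rw 2 [h]; exact add_neg_cancel a
  rcases smul_eq_zero.mp this with h | h
  · exact h2 h
  · exact ha h

omit [Field F] [Fintype F] [DecidableEq F] in
theorem eq_zero_of_forall_mem_span
    (hirr : ∀ U : Submodule k V, (∀ v, ∀ x ∈ U, A v x ∈ U) → U = ⊥ ∨ U = ⊤)
    (hdim : ∀ x : V, Submodule.span k {x} ≠ ⊤) {x : V}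
    (hx : ∀ v, A v x ∈ Submodule.span k {x}) : x = 0 := by
  have hinv : ∀ v, ∀ y ∈ Submodule.span k {x}, A v y ∈ Submodule.span k {x} := fun v y hy => by
    obtain ⟨c, rfl⟩ := Submodule.mem_span_singleton.mp hy
    rw [map_smul]
    exact Submodule.smul_mem _ _ (hx v)
  rcases hirr _ hinv with h | h
  · exact Submodule.span_singleton_eq_bot.mp h
  · exact absurd h (hdim x)

theorem WeilSystem.unit_self_ne_zero (hA : WeilSystem φ A) (hφ : φ ≠ 1)
    (h2 : (2 : F) ≠ 0) (hX : (Fintype.card (Fin r → F) : k) ≠ 0)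
    (hirr : ∀ U : Submodule k V, (∀ v, ∀ x ∈ U, A v x ∈ U) → U = ⊥ ∨ U = ⊤)
    (hdim : ∀ x : V, Submodule.span k {x} ≠ ⊤) {ξ : Fin r → F} (hξ : ξ ≠ 0) :
    unit φ A ξ ξ ≠ 0 := by
  intro h0
  have h1 : ∀ a, unit φ A a ξ = 0 := fun a => by
    have := hA.unit_mul hφ h2 hX a ξ ξ ξ
    rw [h0, mul_zero, if_pos rfl, if_neg (ne_neg_self h2 hξ), add_zero] at this
    exact this.symm
  have h3 : ∀ a, a ≠ 0 → unit φ A a a = 0 := fun a ha => by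
    by_cases e : ξ = -ξ
    · exact absurd e (ne_neg_self h2 hξ)
    · have := hA.unit_mul hφ h2 hX a ξ ξ a
      rw [h1, zero_mul, if_pos rfl, if_neg e, add_zero] at this
      exact this.symm
  have h4 : ∀ a b, a ≠ 0 → unit φ A a b = 0 := fun a b ha => by
    have := hA.unit_mul hφ h2 hX a a a b
    rw [h3 a ha, zero_mul, if_pos rfl, if_neg (ne_neg_self h2 ha), add_zero] at this
    exact this.symm
  have h5 : ∀ a b, b ≠ 0 → unit φ A a b = 0 := fun a b hb => by
    have := hA.unit_mul hφ h2 hX a b b b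
    rw [h3 b hb, mul_zero, if_pos rfl, if_neg (ne_neg_self h2 hb), add_zero] at this
    exact this.symm
  have h6 : unit φ A 0 0 = (2 : k) • 1 := by
    have := sum_unit (A := A) hφ h2 hX 0 0
    rw [Finset.sum_eq_single 0 (fun b _ hb => by rw [h5 _ b hb, smul_zero]) (by simp)] at this
    rw [show (Sum.elim 0 0 : Vec r F) = 0 by ext i; cases i <;> rfl, hA.zero] at this
    simpa using this.symm
  have : ∀ x : V, x = 0 := fun x => by
    refine eq_zero_of_forall_mem_span hirr hdim (mem_of_unit_mem hφ h2 hX fun c d => ?_)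
    by_cases hc : c = 0
    · by_cases hd : d = 0
      · subst hc hd
        rw [h6]
        exact Submodule.smul_mem _ _ (Submodule.mem_span_singleton_self x)
      · rw [h5 _ _ hd]; exact zero_mem _
    · rw [h4 _ _ hc]; exact zero_mem _
  refine hdim 0 ?_
  rw [eq_top_iff]
  intro x _
  rw [this x]; exact zero_mem _

theorem WeilSystem.exists_frame (hA : WeilSystem φ A) (hφ : φ ≠ 1)
    (h2 : (2 : F) ≠ 0) (hX : (Fintype.card (Fin r → F) : k) ≠ 0)
    (hirr : ∀ U : Submodule k V, (∀ v, ∀ x ∈ U, A v x ∈ U) → U = ⊥ ∨ U = ⊤)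
    (hdim : ∀ x : V, Submodule.span k {x} ≠ ⊤) {ξ : Fin r → F} (hξ : ξ ≠ 0) :
    ∃ w ε, WeilFrame φ A ξ w ε := by
  have hne := hA.unit_self_ne_zero hφ h2 hX hirr hdim hξ
  have hm := fun a b c d (x : V) =>
    LinearMap.congr_fun (hA.unit_mul hφ h2 hX a b c d) x
  simp only [Module.End.mul_apply, LinearMap.add_apply] at hm
  have hn := ne_neg_self h2 hξ
  obtain ⟨z, ε, hz, hε, hPz, hNz⟩ : ∃ z : V, ∃ ε : k, z ≠ 0 ∧ (ε = 1 ∨ ε = -1) ∧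
      unit φ A ξ ξ z = z ∧ unit φ A (-ξ) ξ z = ε • z := by
    obtain ⟨y, hy⟩ : ∃ y, unit φ A ξ ξ y ≠ 0 := by
      by_contra! h
      exact hne (LinearMap.ext h)
    have hPP : unit φ A ξ ξ (unit φ A ξ ξ y) = unit φ A ξ ξ y := by
      rw [hm, if_pos rfl, if_neg hn]; simp
    have hNP : unit φ A (-ξ) ξ (unit φ A ξ ξ y) = unit φ A (-ξ) ξ y := by
      rw [hm, if_pos rfl, if_neg hn]; simp
    have hPN : unit φ A ξ ξ (unit φ A (-ξ) ξ y) = unit φ A (-ξ) ξ y := by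
      rw [hm, if_neg hn, if_pos (neg_neg ξ).symm, ← hA.unit_neg, neg_neg]; simp
    have hNN : unit φ A (-ξ) ξ (unit φ A (-ξ) ξ y) = unit φ A ξ ξ y := by
      rw [hm, if_neg hn, if_pos (neg_neg ξ).symm, hA.unit_neg]; simp
    by_cases h : unit φ A ξ ξ y + unit φ A (-ξ) ξ y = 0
    · refine ⟨unit φ A ξ ξ y, -1, hy, Or.inr rfl, hPP, ?_⟩
      rw [hNP, neg_one_smul]
      exact (neg_eq_of_add_eq_zero_right h).symm
    · refine ⟨_, 1, h, Or.inl rfl, ?_, ?_⟩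
      · rw [map_add, hPP, hPN]
      · rw [map_add, hNP, hNN, one_smul, add_comm]
  have hflip : ∀ c, unit φ A c (-ξ) z = ε • unit φ A c ξ z := fun c => by
    rw [← map_smul, ← hNz, hm, if_neg hn, if_pos (neg_neg ξ).symm]; simp
  have hneg : ∀ a, unit φ A (-a) ξ z = ε • unit φ A a ξ z := fun a => by
    rw [← hflip, ← hA.unit_neg a, neg_neg]
  have hap : ∀ c d a, unit φ A c d (unit φ A a ξ z) =
      (if d = a then unit φ A c ξ z else 0) + (if d = -a then ε • unit φ A c ξ z else 0) := by
    intro c d a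
    rw [hm, ← hflip]
    split_ifs <;> simp
  have hspan : Submodule.span k (Set.range fun a => unit φ A a ξ z) = ⊤ := by
    refine (hirr _ fun v x hx => ?_).resolve_left fun h => hz ?_
    · refine mem_of_unit_mem hφ h2 hX (fun c d => ?_) v
      have hle : Submodule.span k (Set.range fun a => unit φ A a ξ z) ≤
          (Submodule.span k (Set.range fun a => unit φ A a ξ z)).comap (unit φ A c d) := by
        rw [Submodule.span_le]
        rintro _ ⟨a, rfl⟩
        have hc := Submodule.subset_span (R := k) (Set.mem_range_self (f := fun a => unit φ A a ξ z) c)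
        show unit φ A c d (unit φ A a ξ z) ∈ Submodule.span k (Set.range fun a => unit φ A a ξ z)
        rw [hap]
        refine Submodule.add_mem _ ?_ ?_
        · split_ifs
          · exact hc
          · exact zero_mem _
        · split_ifs
          · exact Submodule.smul_mem _ _ hc
          · exact zero_mem _
      exact hle hx
    · have := Submodule.subset_span (R := k) (Set.mem_range_self (f := fun a => unit φ A a ξ z) ξ)
      rw [h] at this
      rw [← hPz]; exact this
  refine ⟨fun a => unit φ A a ξ z, ε, hε, hneg, hap, hspan, ?_, ?_⟩
  · simpa only [hPz] using hz
  · constructor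
    · intro h0
      have h0 : unit φ A 0 ξ z = 0 := h0
      have := hap ξ 0 0
      rw [h0, map_zero, if_pos rfl, if_pos neg_zero.symm, hPz] at this
      have h3 : (1 + ε) • z = 0 := by rw [add_smul, one_smul]; exact this.symm
      rw [smul_eq_zero, or_iff_left hz] at h3
      exact (neg_eq_of_add_eq_zero_right h3).symm
    · rintro rfl
      refine eq_zero_of_forall_mem_span (x := unit φ A 0 ξ z) hirr hdim
        (mem_of_unit_mem hφ h2 hX fun c d => ?_)
      rw [hap, neg_zero]
      split_ifs <;> simp

end Frame

section HalfSystem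

variable {r : ℕ} {F : Type*} [Field F] [Fintype F] [DecidableEq F]

variable (r F) in
/-- A set of representatives of the pairs `{a, -a}` of opposite nonzero vectors. -/
noncomputable def halfSystem : Finset (Fin r → F) :=
  {a | Fintype.equivFin _ a < Fintype.equivFin _ (-a)}

omit [DecidableEq F] in
theorem neg_notMem_halfSystem {a : Fin r → F} (ha : a ∈ halfSystem r F) :
    -a ∉ halfSystem r F := by
  simp only [halfSystem, Finset.mem_filter_univ, neg_neg] at ha ⊢
  exact ha.asymm

omit [DecidableEq F] in
theorem zero_notMem_halfSystem : (0 : Fin r → F) ∉ halfSystem r F := by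
  simp [halfSystem]

omit [DecidableEq F] in
theorem mem_halfSystem_or (h2 : (2 : F) ≠ 0) {a : Fin r → F} (ha : a ≠ 0) :
    a ∈ halfSystem r F ∨ -a ∈ halfSystem r F := by
  simp only [halfSystem, Finset.mem_filter_univ, neg_neg]
  exact lt_or_gt_of_ne fun h => ne_neg_self h2 ha ((Fintype.equivFin _).injective h)

theorem two_mul_card_halfSystem (h2 : (2 : F) ≠ 0) :
    2 * (halfSystem r F).card + 1 = Fintype.card F ^ r := by
  have e : (Finset.univ : Finset (Fin r → F)) =
      insert 0 (halfSystem r F ∪ (halfSystem r F).map (Equiv.neg _).toEmbedding) := by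
    ext a
    by_cases ha : a = 0
    · simp [ha]
    · simp only [Finset.mem_univ, Finset.mem_insert, ha, false_or, Finset.mem_union,
        Finset.mem_map_equiv, true_iff]
      exact mem_halfSystem_or h2 ha
  have hcard : Fintype.card (Fin r → F) = Fintype.card F ^ r := by simp
  rw [← hcard, ← Finset.card_univ, e, Finset.card_insert_of_notMem, Finset.card_union_of_disjoint,
    Finset.card_map]
  · ring
  · rw [Finset.disjoint_left]
    intro a ha h
    rw [Finset.mem_map_equiv] at h
    exact neg_notMem_halfSystem ha h
  · rw [Finset.mem_union, Finset.mem_map_equiv]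
    rintro (h | h)
    · exact zero_notMem_halfSystem h
    · exact zero_notMem_halfSystem (by simpa using h)

end HalfSystem

section FrameBasis

variable {r : ℕ} {F k V V' : Type*} [Field F] [Fintype F] [DecidableEq F] [Field k]
  [AddCommGroup V] [Module k V] [AddCommGroup V'] [Module k V']
  {φ : AddChar F k} {A : Vec r F → Module.End k V} {A' : Vec r F → Module.End k V'}
  {ξ : Fin r → F} {w : (Fin r → F) → V} {w' : (Fin r → F) → V'} {ε ε' : k}

open Classical in
variable (r F) in
/-- The indices of the nonzero vectors of a frame, up to sign. -/
noncomputable def frameIndex (ε : k) : Finset (Fin r → F) :=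
  if ε = -1 then halfSystem r F else insert 0 (halfSystem r F)

theorem mem_frameIndex {a : Fin r → F} :
    a ∈ frameIndex r F ε ↔ a ∈ halfSystem r F ∨ (a = 0 ∧ ε ≠ -1) := by
  unfold frameIndex
  split_ifs with h
  · simp [h]
  · simp [h, or_comm]

theorem card_frameIndex_of_eq (h : ε = -1) :
    (frameIndex r F ε).card = (halfSystem r F).card := by
  rw [frameIndex, if_pos h]

theorem card_frameIndex_of_ne (h : ε ≠ -1) :
    (frameIndex r F ε).card = (halfSystem r F).card + 1 := by
  rw [frameIndex, if_neg h, Finset.card_insert_of_notMem zero_notMem_halfSystem]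

theorem WeilFrame.linearIndependent (hw : WeilFrame φ A ξ w ε) :
    LinearIndependent k fun a : frameIndex r F ε => w a := by
  rw [linearIndependent_iff']
  intro s g hg d hd
  have h1 := congrArg (unit φ A ξ d.1) hg
  rw [map_sum, map_zero, Finset.sum_eq_single d] at h1
  · rw [map_smul, hw.unit_apply, if_pos rfl, smul_eq_zero] at h1
    refine h1.resolve_right fun h => ?_
    have hd' := mem_frameIndex.mp d.2
    split_ifs at h with h3
    · have h4 : (1 + ε) • w ξ = 0 := by rw [add_smul, one_smul]; exact h
      rw [smul_eq_zero, or_iff_left hw.ne_zero] at h4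
      rcases hd' with hd' | hd'
      · exact neg_notMem_halfSystem hd' (h3 ▸ hd')
      · exact hd'.2 (neg_eq_of_add_eq_zero_right h4).symm
    · rw [add_zero] at h
      exact hw.ne_zero h
  · intro j _ hj
    rw [map_smul, hw.unit_apply, if_neg fun h => hj (Subtype.ext h.symm), if_neg, add_zero,
      smul_zero]
    intro h
    rcases mem_frameIndex.mp d.2 with hd | hd <;> rcases mem_frameIndex.mp j.2 with hj' | hj'
    · exact neg_notMem_halfSystem hj' (h ▸ hd)
    · rw [hj'.1, neg_zero] at h
      exact zero_notMem_halfSystem (h ▸ hd)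
    · rw [hd.1, eq_comm, neg_eq_zero] at h
      exact zero_notMem_halfSystem (h ▸ hj')
    · exact hj (Subtype.ext (hj'.1.trans hd.1.symm))
  · intro h; exact absurd hd h

theorem WeilFrame.mem_span (h2 : (2 : F) ≠ 0) (hw : WeilFrame φ A ξ w ε) (a : Fin r → F) :
    w a ∈ Submodule.span k (Set.range fun a : frameIndex r F ε => w a) := by
  have hmem : ∀ b ∈ frameIndex r F ε,
      w b ∈ Submodule.span k (Set.range fun a : frameIndex r F ε => w a) :=
    fun b hb => Submodule.subset_span ⟨⟨b, hb⟩, rfl⟩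
  by_cases ha : a = 0
  · subst ha
    by_cases h : ε = -1
    · rw [hw.zero_iff.mpr h]; exact zero_mem _
    · exact hmem 0 (mem_frameIndex.mpr (Or.inr ⟨rfl, h⟩))
  · rcases mem_halfSystem_or h2 ha with h | h
    · exact hmem a (mem_frameIndex.mpr (Or.inl h))
    · have := hw.neg (-a)
      rw [neg_neg] at this
      rw [this]
      exact Submodule.smul_mem _ _ (hmem _ (mem_frameIndex.mpr (Or.inl h)))

/-- The basis extracted from a frame. -/
noncomputable def WeilFrame.basis (h2 : (2 : F) ≠ 0) (hw : WeilFrame φ A ξ w ε) :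
    Basis (frameIndex r F ε) k V :=
  Basis.mk hw.linearIndependent <| by
    rw [← hw.span, Submodule.span_le]
    rintro _ ⟨a, rfl⟩
    exact hw.mem_span h2 a

theorem WeilFrame.finrank_eq (h2 : (2 : F) ≠ 0) (hw : WeilFrame φ A ξ w ε) :
    finrank k V = (frameIndex r F ε).card := by
  rw [finrank_eq_card_basis (hw.basis h2), Fintype.card_coe]

theorem WeilFrame.eps_eq (h2 : (2 : F) ≠ 0) (hw : WeilFrame φ A ξ w ε)
    (hw' : WeilFrame φ A' ξ w' ε') (h : finrank k V = finrank k V') : ε = ε' := by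
  rw [hw.finrank_eq h2, hw'.finrank_eq h2] at h
  by_cases h1 : ε = -1 <;> by_cases h3 : ε' = -1
  · rw [h1, h3]
  · rw [card_frameIndex_of_eq h1, card_frameIndex_of_ne h3] at h; omega
  · rw [card_frameIndex_of_ne h1, card_frameIndex_of_eq h3] at h; omega
  · rw [hw.eps.resolve_right h1, hw'.eps.resolve_right h3]

theorem WeilFrame.exists_linearEquiv (h2 : (2 : F) ≠ 0) (hw : WeilFrame φ A ξ w ε)
    (hw' : WeilFrame φ A' ξ w' ε) : ∃ e : V ≃ₗ[k] V', ∀ a, e (w a) = w' a := by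
  let e := (hw.basis h2).equiv (hw'.basis h2) (Equiv.refl _)
  have h : ∀ b ∈ frameIndex r F ε, e (w b) = w' b := fun b hb => by
    have h1 : hw.basis h2 ⟨b, hb⟩ = w b := by simp [WeilFrame.basis]
    have h3 : hw'.basis h2 ⟨b, hb⟩ = w' b := by simp [WeilFrame.basis]
    rw [← h1, Basis.equiv_apply, Equiv.refl_apply, h3]
  refine ⟨e, fun a => ?_⟩
  by_cases ha : a = 0
  · subst ha
    by_cases hε : ε = -1
    · rw [hw.zero_iff.mpr hε, hw'.zero_iff.mpr hε, map_zero]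
    · exact h 0 (mem_frameIndex.mpr (Or.inr ⟨rfl, hε⟩))
  · rcases mem_halfSystem_or h2 ha with h1 | h1
    · exact h a (mem_frameIndex.mpr (Or.inl h1))
    · have h3 := hw.neg (-a)
      have h4 := hw'.neg (-a)
      rw [neg_neg] at h3 h4
      rw [h3, h4, map_smul, h _ (mem_frameIndex.mpr (Or.inl h1))]

end FrameBasis

section LowRank

variable {r : ℕ} {F k V V' : Type*} [Field F] [Fintype F] [Field k]
  [AddCommGroup V] [Module k V] [AddCommGroup V'] [Module k V'] {ψ : AddChar F k}
  {ρ : Sp r F →* (V →ₗ[k] V)} {ρ' : Sp r F →* (V' →ₗ[k] V')}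

omit [Fintype F] in
theorem quarter_ne_zero (h2 : (2 : F) ≠ 0) : (1 / 4 : F) ≠ 0 := by
  rw [show (4 : F) = 2 * 2 by norm_num]
  exact one_div_ne_zero (mul_ne_zero h2 h2)

theorem weilSystem_weil (h2 : (2 : F) ≠ 0) (hψ : ψ ≠ 1) (hF : (Fintype.card F : k) ≠ 0)
    (hρ : SquareType ψ ρ) : WeilSystem (ψ.mulShift (1 / 4)) (weil ψ ρ) where
  zero := LinearMap.ext fun x => weil_zero hψ hF x
  neg := weil_neg
  mul v w := LinearMap.ext fun x => by
    have := weil_mul h2 hψ hF hρ v w x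
    simpa [AddChar.mulShift_apply, div_eq_inv_mul] using this

/-- An irreducible nontrivial representation of small rank in which the weight `1` occurs. -/
structure LowRank (ψ : AddChar F k) (ρ : Sp r F →* (V →ₗ[k] V)) : Prop where
  irred : ∀ U : Submodule k V, (∀ g, ∀ x ∈ U, ρ g x ∈ U) → U = ⊥ ∨ U = ⊤
  ne_one : ρ ≠ 1
  smallRank : SmallRank ψ ρ
  one : ∃ u, lineWeight ψ ρ u 1 ≠ ⊥
  one_lt : 1 < finrank k V

theorem LowRank.squareType (h2 : (2 : F) ≠ 0) (hr : 2 ≤ r) (hψ : ψ ≠ 1)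
    (hF : (Fintype.card F : k) ≠ 0) (hρ : LowRank ψ ρ) : SquareType ψ ρ where
  smallRank := hρ.smallRank
  span _ _ hvw := planeSpan_sq_eq_top h2 hr hψ hF hρ.smallRank hρ.irred hρ.ne_one hρ.one hvw

theorem LowRank.exists_frame [DecidableEq F] (h2 : (2 : F) ≠ 0) (hr : 2 ≤ r) (hψ : ψ ≠ 1)
    (hF : (Fintype.card F : k) ≠ 0) (hρ : LowRank ψ ρ) {ξ : Fin r → F} (hξ : ξ ≠ 0) :
    ∃ w ε, WeilFrame (ψ.mulShift (1 / 4)) (weil ψ ρ) ξ w ε := by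
  have hS := hρ.squareType h2 hr hψ hF
  refine (weilSystem_weil h2 hψ hF hS).exists_frame
    (AddChar.IsPrimitive.of_ne_one hψ (quarter_ne_zero h2)) h2 ?_ ?_ ?_ hξ
  · rw [Fintype.card_fun, Fintype.card_fin, Nat.cast_pow]
    exact pow_ne_zero _ hF
  · intro U hU
    exact hρ.irred U fun g => rep_mem_of_weil_mem h2 hψ hF
      (fun v a ha => hS.lineWeight_eq_bot hψ hF v ha) hU g
  · intro x hx
    have h1 : finrank k V ≤ 1 := by
      rw [← finrank_top, ← hx]
      exact (finrank_span_le_card {x}).trans (by simp)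
    exact absurd hρ.one_lt (by omega)

omit [Fintype F] in
theorem exists_index_ne_zero (hr : 2 ≤ r) : ∃ ξ : Fin r → F, ξ ≠ 0 :=
  ⟨Pi.single ⟨0, by omega⟩ 1, by simp⟩

/-- The dimension of a representation of low rank is `(q ^ r - 1) / 2` or `(q ^ r + 1) / 2`. -/
theorem LowRank.finrank_eq (h2 : (2 : F) ≠ 0) (hr : 2 ≤ r) (hψ : ψ ≠ 1)
    (hF : (Fintype.card F : k) ≠ 0) (hρ : LowRank ψ ρ) :
    2 * finrank k V + 1 = Fintype.card F ^ r ∨ 2 * finrank k V = Fintype.card F ^ r + 1 := by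
  classical
  obtain ⟨ξ, hξ⟩ := exists_index_ne_zero (F := F) hr
  obtain ⟨w, ε, hw⟩ := hρ.exists_frame h2 hr hψ hF hξ
  rw [hw.finrank_eq h2, ← two_mul_card_halfSystem h2]
  by_cases h : ε = -1
  · rw [card_frameIndex_of_eq h]; omega
  · rw [card_frameIndex_of_ne h]; omega

theorem lineProj_prod (v : Vec r F) (a : F) (x : V × V') :
    lineProj ψ (Representation.prod ρ ρ') v a x =
      (lineProj ψ ρ v a x.1, lineProj ψ ρ' v a x.2) := by
  simp only [lineProj_apply]
  ext
  · simp [Prod.fst_sum]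
  · simp [Prod.snd_sum]

theorem weil_prod (v : Vec r F) (x : V × V') :
    weil ψ (Representation.prod ρ ρ') v x = (weil ψ ρ v x.1, weil ψ ρ' v x.2) := by
  simp only [weil, LinearMap.sum_apply, LinearMap.smul_apply, lineProj_prod]
  ext
  · simp [Prod.fst_sum]
  · simp [Prod.snd_sum]

theorem unit_prod (φ : AddChar F k) (c d : Fin r → F) (x : V × V') :
    unit φ (weil ψ (Representation.prod ρ ρ')) c d x =
      (unit φ (weil ψ ρ) c d x.1, unit φ (weil ψ ρ') c d x.2) := by
  simp only [unit, LinearMap.sum_apply, LinearMap.smul_apply, weil_prod]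
  ext
  · simp [Prod.fst_sum]
  · simp [Prod.snd_sum]

omit [Fintype F] in
theorem lineWeight_prod_eq_bot {v : Vec r F} {a : F} (h : lineWeight ψ ρ v a = ⊥)
    (h' : lineWeight ψ ρ' v a = ⊥) : lineWeight ψ (Representation.prod ρ ρ') v a = ⊥ := by
  rw [Submodule.eq_bot_iff] at h h' ⊢
  intro x hx
  exact Prod.ext (h _ fun c => congrArg Prod.fst (hx c)) (h' _ fun c => congrArg Prod.snd (hx c))

/-- Representations of low rank are determined by the character and the dimension. -/
theorem LowRank.exists_equiv (h2 : (2 : F) ≠ 0) (hr : 2 ≤ r) (hψ : ψ ≠ 1)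
    (hF : (Fintype.card F : k) ≠ 0) (hρ : LowRank ψ ρ) (hρ' : LowRank ψ ρ')
    (hdim : finrank k V = finrank k V') :
    ∃ e : V ≃ₗ[k] V', ∀ g x, e (ρ g x) = ρ' g (e x) := by
  classical
  obtain ⟨ξ, hξ⟩ := exists_index_ne_zero (F := F) hr
  obtain ⟨w, ε, hw⟩ := hρ.exists_frame h2 hr hψ hF hξ
  obtain ⟨w', ε', hw'⟩ := hρ'.exists_frame h2 hr hψ hF hξ
  obtain rfl := hw.eps_eq h2 hw' hdim
  obtain ⟨e, he⟩ := hw.exists_linearEquiv h2 hw'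
  refine ⟨e, fun g x => ?_⟩
  have hφ := AddChar.IsPrimitive.of_ne_one hψ (quarter_ne_zero h2)
  have hX : (Fintype.card (Fin r → F) : k) ≠ 0 := by
    rw [Fintype.card_fun, Fintype.card_fin, Nat.cast_pow]
    exact pow_ne_zero _ hF
  let N : Submodule k (V × V') := LinearMap.graph (e : V →ₗ[k] V')
  have hN : ∀ v, ∀ y ∈ N, weil ψ (Representation.prod ρ ρ') v y ∈ N := by
    intro v y hy
    refine mem_of_unit_mem hφ h2 hX (fun c d => ?_) v
    have hy2 : y = (y.1, e y.1) := Prod.ext rfl hy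
    have key : (unit (ψ.mulShift (1 / 4)) (weil ψ ρ') c d) ∘ₗ (e : V →ₗ[k] V') =
        (e : V →ₗ[k] V') ∘ₗ (unit (ψ.mulShift (1 / 4)) (weil ψ ρ) c d) := by
      refine LinearMap.ext_on_range hw.span fun a => ?_
      simp only [LinearMap.comp_apply, LinearEquiv.coe_coe, he, hw.unit_apply, hw'.unit_apply]
      split_ifs <;> simp [he]
    rw [unit_prod, hy2]
    exact LinearMap.congr_fun key y.1
  have := rep_mem_of_weil_mem h2 hψ hF (fun v a ha => lineWeight_prod_eq_bot
    ((hρ.squareType h2 hr hψ hF).lineWeight_eq_bot hψ hF v ha)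
    ((hρ'.squareType h2 hr hψ hF).lineWeight_eq_bot hψ hF v ha)) hN g (x, e x) rfl
  exact this.symm

end LowRank

section Separation

theorem exists_addChar_ne_one (F k : Type*) [Field F] [Fintype F] [Field k] [IsAlgClosed k]
    (hF : (Fintype.card F : k) ≠ 0) : ∃ ψ : AddChar F k, ψ ≠ 1 := by
  have h : ringChar k ≠ ringChar F := fun h => hF <| by
    rw [ringChar.spec, h, ← ringChar.spec]
    exact Nat.cast_card_eq_zero F
  let P := AddChar.FiniteField.primitiveChar F k h
  have : FiniteDimensional k (CyclotomicField P.n k) :=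
    inferInstanceAs (FiniteDimensional k (Polynomial.cyclotomic P.n k).SplittingField)
  let f : CyclotomicField P.n k →ₐ[k] k := IsAlgClosed.lift
  obtain ⟨a, ha⟩ := AddChar.ne_one_iff.mp (P.prim one_ne_zero)
  refine ⟨(f : CyclotomicField P.n k →* k).compAddChar P.char, AddChar.ne_one_iff.mpr ⟨a, ?_⟩⟩
  intro h1
  apply ha
  rw [AddChar.mulShift_apply, one_mul]
  apply f.toRingHom.injective
  rw [map_one]
  exact h1

variable {r : ℕ} {F k V V' : Type*} [Field F] [Fintype F] [Field k]
  [AddCommGroup V] [Module k V] [AddCommGroup V'] [Module k V'] {ψ : AddChar F k}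
  {ρ : Sp r F →* (V →ₗ[k] V)} {ρ' : Sp r F →* (V' →ₗ[k] V')}

omit [Fintype F] in
theorem lineWeight_sq_le {u : Vec r F} {s : F} (hs : s ≠ 0) (b : F) :
    lineWeight ψ ρ u (b * s ^ 2) ≤ lineWeight (ψ.mulShift b) ρ (s⁻¹ • u) 1 := by
  intro x hx c
  rw [transv_smul, hx, AddChar.mulShift_apply]
  congr 2
  field_simp

theorem exists_sq_mul_of_not_isSquare (h2 : ringChar F ≠ 2) {a b : F} (ha : ¬ IsSquare a)
    (hb : ¬ IsSquare b) : ∃ s, s ≠ 0 ∧ a = b * s ^ 2 := by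
  have ha0 : a ≠ 0 := fun h => ha (h ▸ IsSquare.zero)
  have hb0 : b ≠ 0 := fun h => hb (h ▸ IsSquare.zero)
  have hab : IsSquare (a / b) := by
    rw [FiniteField.isSquare_iff h2 (div_ne_zero ha0 hb0), div_pow,
      (FiniteField.pow_dichotomy h2 ha0).resolve_left
        (fun h => ha ((FiniteField.isSquare_iff h2 ha0).mpr h)),
      (FiniteField.pow_dichotomy h2 hb0).resolve_left
        (fun h => hb ((FiniteField.isSquare_iff h2 hb0).mpr h))]
    norm_num
  obtain ⟨s, hs⟩ := hab
  have hs2 : a = b * s ^ 2 := by rw [pow_two, ← hs, mul_div_cancel₀ _ hb0]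
  refine ⟨s, fun h => ha0 ?_, hs2⟩
  rw [hs2, h]; ring

theorem lowRank_or_lowRank [FiniteDimensional k V] (hchar : ringChar F ≠ 2) (hψ : ψ ≠ 1)
    (hF : (Fintype.card F : k) ≠ 0) (hr : 2 ≤ r)
    (hsmall : 2 * (Fintype.card F + 1) * finrank k V <
      (Fintype.card F ^ r - 1) * (Fintype.card F ^ r - Fintype.card F))
    (hirr : ∀ U : Submodule k V, (∀ g, ∀ x ∈ U, ρ g x ∈ U) → U = ⊥ ∨ U = ⊤) (hρ : ρ ≠ 1)
    (hone : 1 < finrank k V) {b : F} (hb : ¬ IsSquare b) :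
    LowRank ψ ρ ∨ LowRank (ψ.mulShift b) ρ := by
  have h2 : (2 : F) ≠ 0 := Ring.two_ne_zero hchar
  have hb0 : b ≠ 0 := fun h => hb (h ▸ IsSquare.zero)
  have hS := smallRank_of_finrank_lt (ρ := ρ) h2 hψ hF hr hsmall
  have hS' := smallRank_of_finrank_lt (ρ := ρ) h2
    (AddChar.IsPrimitive.of_ne_one hψ hb0) hF hr hsmall
  obtain ⟨u, a, ha0, ha⟩ : ∃ u a, a ≠ 0 ∧ lineWeight ψ ρ u a ≠ ⊥ := by
    by_contra! h
    obtain ⟨v, hv⟩ : ∃ v : Vec r F, v ≠ 0 := ⟨Pi.single (Sum.inl ⟨0, by omega⟩) 1, by simp⟩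
    obtain ⟨w, hw⟩ := form_nondegenerate hv
    have htop := planeSpan_ne_zero_eq_top h2 hr hS hirr hρ hw
    have hbot : planeSpan ψ ρ v w {a | a ≠ 0} ≤ ⊥ :=
      planeSpan_le fun u _ a ha => (h u a ha).le
    rw [htop, top_le_iff] at hbot
    have : Subsingleton V := (Submodule.subsingleton_iff k).mp (subsingleton_of_bot_eq_top hbot)
    rw [finrank_zero_of_subsingleton] at hone
    omega
  by_cases hs : IsSquare a
  · left
    obtain ⟨s, rfl⟩ := hs
    have hs0 : s ≠ 0 := fun h => ha0 (by simp [h])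
    refine ⟨hirr, hρ, hS, ⟨s⁻¹ • u, fun h => ha ?_⟩, hone⟩
    have := lineWeight_sq_le (ψ := ψ) (ρ := ρ) (u := u) hs0 1
    rw [AddChar.mulShift_one, h, one_mul, pow_two, le_bot_iff] at this
    exact this
  · right
    obtain ⟨s, hs0, rfl⟩ := exists_sq_mul_of_not_isSquare hchar hs hb
    refine ⟨hirr, hρ, hS', ⟨s⁻¹ • u, fun h => ha ?_⟩, hone⟩
    have := lineWeight_sq_le (ψ := ψ) (ρ := ρ) (u := u) hs0 b
    rwa [h, le_bot_iff] at this

/-- Below the gap bound an irreducible nontrivial representation has the dimension of a Weil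
representation. -/
theorem finrank_eq_of_lt_gap [IsAlgClosed k] [FiniteDimensional k V] (hchar : ringChar F ≠ 2)
    (hF : (Fintype.card F : k) ≠ 0) (hr : 2 ≤ r)
    (hsmall : 2 * (Fintype.card F + 1) * finrank k V <
      (Fintype.card F ^ r - 1) * (Fintype.card F ^ r - Fintype.card F))
    (hirr : ∀ U : Submodule k V, (∀ g, ∀ x ∈ U, ρ g x ∈ U) → U = ⊥ ∨ U = ⊤) (hρ : ρ ≠ 1)
    (hone : 1 < finrank k V) :
    2 * finrank k V + 1 = Fintype.card F ^ r ∨ 2 * finrank k V = Fintype.card F ^ r + 1 := by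
  obtain ⟨ψ, hψ⟩ := exists_addChar_ne_one F k hF
  obtain ⟨b, hb⟩ := FiniteField.exists_nonsquare hchar
  have h2 : (2 : F) ≠ 0 := Ring.two_ne_zero hchar
  have hb0 : b ≠ 0 := fun h => hb (h ▸ IsSquare.zero)
  rcases lowRank_or_lowRank hchar hψ hF hr hsmall hirr hρ hone hb with h | h
  · exact h.finrank_eq h2 hr hψ hF
  · exact h.finrank_eq h2 hr (AddChar.IsPrimitive.of_ne_one hψ hb0) hF

variable (r F k V) in
/-- Below the gap bound the irreducible nontrivial representations of a given dimension fall into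
at most two isomorphism classes. -/
theorem exists_separating_pred [IsAlgClosed k] [FiniteDimensional k V] (hchar : ringChar F ≠ 2)
    (hF : (Fintype.card F : k) ≠ 0) (hr : 2 ≤ r)
    (hsmall : 2 * (Fintype.card F + 1) * finrank k V <
      (Fintype.card F ^ r - 1) * (Fintype.card F ^ r - Fintype.card F))
    (hone : 1 < finrank k V) :
    ∃ S : (Sp r F →* (V →ₗ[k] V)) → Prop, ∀ ρ ρ' : Sp r F →* (V →ₗ[k] V),
      (∀ U : Submodule k V, (∀ g, ∀ x ∈ U, ρ g x ∈ U) → U = ⊥ ∨ U = ⊤) → ρ ≠ 1 →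
      (∀ U : Submodule k V, (∀ g, ∀ x ∈ U, ρ' g x ∈ U) → U = ⊥ ∨ U = ⊤) → ρ' ≠ 1 →
      (S ρ ↔ S ρ') → ∃ e : V ≃ₗ[k] V, ∀ g x, e (ρ g x) = ρ' g (e x) := by
  obtain ⟨ψ, hψ⟩ := exists_addChar_ne_one F k hF
  obtain ⟨b, hb⟩ := FiniteField.exists_nonsquare hchar
  have h2 : (2 : F) ≠ 0 := Ring.two_ne_zero hchar
  have hb0 : b ≠ 0 := fun h => hb (h ▸ IsSquare.zero)
  refine ⟨LowRank ψ, fun ρ ρ' hi h1 hi' h1' hS => ?_⟩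
  by_cases h : LowRank ψ ρ
  · exact h.exists_equiv h2 hr hψ hF (hS.mp h) rfl
  · have h' : ¬ LowRank ψ ρ' := fun h' => h (hS.mpr h')
    exact ((lowRank_or_lowRank hchar hψ hF hr hsmall hi h1 hone hb).resolve_left h).exists_equiv
      h2 hr (AddChar.IsPrimitive.of_ne_one hψ hb0) hF
      ((lowRank_or_lowRank hchar hψ hF hr hsmall hi' h1' hone hb).resolve_left h') rfl

theorem add_two_lt_pow {r p q : ℕ} (hr : 2 ≤ r) (hp : 2 ≤ p) (hpq : p + 2 ≤ q) :
    p ^ r + 2 < q ^ r := by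
  obtain ⟨s, rfl⟩ : ∃ s, r = s + 1 := ⟨r - 1, by omega⟩
  have h1 : p ≤ p ^ s := Nat.le_self_pow (by omega) p
  have h3 : p ^ s ≤ q ^ s := Nat.pow_le_pow_left (by omega) s
  calc p ^ (s + 1) + 2 < p ^ s * (p + 2) := by rw [pow_succ]; nlinarith
    _ ≤ q ^ s * q := Nat.mul_le_mul h3 hpq
    _ = q ^ (s + 1) := (pow_succ _ _).symm

end Separation

end SymplecticGap

theorem count_below_gap_Sp (ℓ : ℕ) (hℓ : ℓ.Prime)
    (k : Type*) [Field k] [IsAlgClosed k] [CharP k ℓ]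
    (r n : ℕ) (hr : 2 ≤ r) (hn : 1 < n)
    (F : ℕ → Type*) [∀ q, Field (F q)] [∀ q, Fintype (F q)]
    (hF : ∀ q, IsPrimePow q → Fintype.card (F q) = q) :
    Nat.card ((q : {q : ℕ // IsPrimePow q ∧ Odd q ∧ ¬ ℓ ∣ q ∧ ¬ (r = 2 ∧ q = 3) ∧
        (n : ℚ) < ((q : ℚ) ^ r - 1) * ((q : ℚ) ^ r - q) / (2 * ((q : ℚ) + 1))}) ×
      Quotient (repIsoSetoid k (Matrix.symplecticGroup (Fin r) (F q)) n
        (fun ρ => ρ ≠ 1 ∧ ρ.IsIrred))) ≤ 2 := by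
  classical
  have hchar : ∀ q, IsPrimePow q → Odd q → ringChar (F q) ≠ 2 := fun q hq hodd h => by
    have := FiniteField.even_card_of_char_two h
    rw [hF q hq] at this
    exact (Nat.not_even_iff_odd.mpr hodd) (Nat.even_iff.mpr this)
  have hcast : ∀ q, IsPrimePow q → ¬ ℓ ∣ q → (Fintype.card (F q) : k) ≠ 0 := fun q hq hd h => by
    rw [hF q hq, CharP.cast_eq_zero_iff k ℓ] at h
    exact hd h
  have hfin : Module.finrank k (Fin n → k) = n := Module.finrank_fin_fun k
  have hsmall : ∀ q : ℕ, IsPrimePow q →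
      (n : ℚ) < ((q : ℚ) ^ r - 1) * ((q : ℚ) ^ r - q) / (2 * ((q : ℚ) + 1)) →
      2 * (Fintype.card (F q) + 1) * Module.finrank k (Fin n → k) <
        (Fintype.card (F q) ^ r - 1) * (Fintype.card (F q) ^ r - Fintype.card (F q)) := by
    intro q hq h
    rw [hF q hq, hfin]
    rw [lt_div_iff₀ (by positivity)] at h
    have h1 : 1 ≤ q ^ r := Nat.one_le_pow _ _ hq.pos
    have h3 : q ≤ q ^ r := Nat.le_self_pow (by omega) q
    have : ((2 * (q + 1) * n : ℕ) : ℚ) < ((q ^ r - 1) * (q ^ r - q) : ℕ) := by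
      push_cast [Nat.cast_sub h1, Nat.cast_sub h3]
      linarith
    exact_mod_cast this
  choose S hS using fun q : {q : ℕ // IsPrimePow q ∧ Odd q ∧ ¬ ℓ ∣ q ∧ ¬ (r = 2 ∧ q = 3) ∧
      (n : ℚ) < ((q : ℚ) ^ r - 1) * ((q : ℚ) ^ r - q) / (2 * ((q : ℚ) + 1))} =>
    SymplecticGap.exists_separating_pred r (F q) k (Fin n → k) (hchar q q.2.1 q.2.2.1)
      (hcast q q.2.1 q.2.2.2.1) hr (hsmall q q.2.1 q.2.2.2.2.2) (by rw [hfin]; exact hn)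
  refine le_of_le_of_eq (Nat.card_le_card_of_injective (β := Bool)
    (fun x => decide (S x.1 x.2.out.1)) ?_) (by simp)
  rintro ⟨q, c⟩ ⟨q', c'⟩ h
  have hdim : ∀ (q : {q : ℕ // IsPrimePow q ∧ Odd q ∧ ¬ ℓ ∣ q ∧ ¬ (r = 2 ∧ q = 3) ∧
      (n : ℚ) < ((q : ℚ) ^ r - 1) * ((q : ℚ) ^ r - q) / (2 * ((q : ℚ) + 1))})
      (_ : Quotient (repIsoSetoid k (Matrix.symplecticGroup (Fin r) (F q)) n
        (fun ρ => ρ ≠ 1 ∧ ρ.IsIrred))),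
      2 * n + 1 = q.1 ^ r ∨ 2 * n = q.1 ^ r + 1 := fun q c => by
    have := SymplecticGap.finrank_eq_of_lt_gap (ρ := c.out.1) (hchar q q.2.1 q.2.2.1)
      (hcast q q.2.1 q.2.2.2.1) hr (hsmall q q.2.1 q.2.2.2.2.2) c.out.2.2 c.out.2.1
      (by rw [hfin]; exact hn)
    rwa [hfin, hF q q.2.1] at this
  have hqq : q = q' := by
    have h1 := hdim q c
    have h3 := hdim q' c'
    obtain ⟨i, hi⟩ := q.2.2.1
    obtain ⟨j, hj⟩ := q'.2.2.1
    have ht := q.2.1.two_le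
    have ht' := q'.2.1.two_le
    by_contra hne
    rcases lt_or_gt_of_ne fun e => hne (Subtype.ext e) with hlt | hlt
    · have := SymplecticGap.add_two_lt_pow hr ht (show q.1 + 2 ≤ q'.1 by omega)
      omega
    · have := SymplecticGap.add_two_lt_pow hr ht' (show q'.1 + 2 ≤ q.1 by omega)
      omega
  subst hqq
  congr 1
  rw [← Quotient.out_equiv_out]
  exact hS q _ _ c.out.2.2 c.out.2.1 c'.out.2.2 c'.out.2.1 (decide_eq_decide.mp h)
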